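/- arXiv:1206.2459 — 4 statements merged into one kernel-verified Lean document; each statement's English description precedes it below -/
import Mathlib

section
/- For any probability measures P and Q on a measurable space, lim_{α↑1} D_α(P‖Q) = D(P‖Q), so that the Rényi divergence of order 1 equals the Kullback-Leibler divergence. Moreover, if D(P‖Q) = ∞ or there exists some β > 1 such that D_β(P‖Q) < ∞, then also lim_{α↓1} D_α(P‖Q) = D(P‖Q). -/
open MeasureTheory Real Filter Set
open scoped ENNReal NNReal Topology Classical

/-- The Hellinger integral `∫ p^α q^(1-α) dμ`, computed with the dominating
measure `μ = P + Q` (the value does not depend on the choice of dominating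
measure). The `ℝ≥0∞`-valued `rpow` automatically implements the conventions
`0/0 = 0` and `x/0 = ∞` for `x > 0` when `α > 1`. -/
noncomputable def hellingerInt {X : Type*} [MeasurableSpace X]
    (α : ℝ) (P Q : Measure X) : ℝ≥0∞ :=
  ∫⁻ x, P.rnDeriv (P + Q) x ^ α * Q.rnDeriv (P + Q) x ^ (1 - α) ∂(P + Q)

/-- Rényi divergence of a simple order `α ∈ (0,1) ∪ (1,∞)`:
`D_α(P‖Q) = (α-1)⁻¹ log ∫ p^α q^(1-α) dμ`. -/
noncomputable def renyiSimple {X : Type*} [MeasurableSpace X]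
    (α : ℝ) (P Q : Measure X) : EReal :=
  (((α - 1)⁻¹ : ℝ) : EReal) * ENNReal.log (hellingerInt α P Q)

/-- Rényi divergence of any order `α ∈ [0,∞]`.  The extended orders `0`, `1`, `∞`
are defined as the limits of the simple orders (the limits exist by monotonicity
in the order, so they coincide with the `limsup`s used here). -/
noncomputable def renyiDiv {X : Type*} [MeasurableSpace X]
    (α : ℝ≥0∞) (P Q : Measure X) : EReal :=
  if α = 0 then Filter.limsup (fun a : ℝ => renyiSimple a P Q) (nhdsWithin (0:ℝ) (Set.Ioi 0))
  else if α = 1 then Filter.limsup (fun a : ℝ => renyiSimple a P Q) (nhdsWithin (1:ℝ) (Set.Iio 1))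
  else if α = ∞ then Filter.limsup (fun a : ℝ => renyiSimple a P Q) Filter.atTop
  else renyiSimple α.toReal P Q

/-- Kullback-Leibler divergence `D(P‖Q) = ∫ p log (p/q) dμ`, with the conventions
`0 log (0/q) = 0` and `p log (p/0) = ∞` for `p > 0`; in particular `D(P‖Q) = ∞`
whenever `P` is not absolutely continuous w.r.t. `Q`, or the integral diverges. -/
noncomputable def klDiv {X : Type*} [MeasurableSpace X] (P Q : Measure X) : EReal :=
  if P ≪ Q ∧ Integrable (llr P Q) P then ((∫ x, llr P Q x ∂P : ℝ) : EReal) else ⊤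

lemma rk_exp_lower {s : ℝ} (hs : 0 < s) (y : ℝ) : y ≤ s⁻¹ * (exp (s * y) - 1) := by
  have := Real.add_one_le_exp (s * y)
  rw [inv_mul_eq_div, le_div_iff₀ hs]
  linarith

lemma rk_exp_upper {s c : ℝ} (hs : 0 < s) (hsc : s ≤ c) (y : ℝ) :
    s⁻¹ * (exp (s * y) - 1) ≤ c⁻¹ * (exp (c * y) - 1) := by
  have hc : 0 < c := hs.trans_le hsc
  have w1 : 0 ≤ s / c := by positivity
  have w2 : 0 ≤ 1 - s / c := by rw [sub_nonneg, div_le_one hc]; exact hsc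
  have h := convexOn_exp.2 (mem_univ (c * y)) (mem_univ 0) w1 w2 (by ring)
  have e : s / c * (c * y) = s * y := by field_simp
  simp only [smul_eq_mul, mul_zero, add_zero, Real.exp_zero, mul_one, e] at h
  rw [inv_mul_eq_div, div_le_iff₀ hs]
  have : c⁻¹ * (exp (c * y) - 1) * s = s / c * exp (c * y) - s / c := by field_simp
  linarith

lemma rk_tendsto_pt (y : ℝ) :
    Tendsto (fun s : ℝ => s⁻¹ * (exp (s * y) - 1)) (𝓝[>] 0) (𝓝 y) := by
  have h : HasDerivAt (fun s : ℝ => exp (s * y)) y 0 := by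
    have := ((hasDerivAt_id (0:ℝ)).mul_const y).exp
    simpa using this
  have h2 := h.tendsto_slope.mono_left (nhdsWithin_mono _ (fun x (hx : 0 < x) => hx.ne'))
  refine h2.congr fun s => ?_
  simp [slope_def_field, div_eq_inv_mul]

lemma rk_integrable_exp {X : Type*} [MeasurableSpace X] {P : Measure X} [IsProbabilityMeasure P]
    {f : X → ℝ} (hf : Measurable f) {c s : ℝ} (hs : 0 < s) (hsc : s ≤ c)
    (hi : Integrable (fun x => exp (c * f x)) P) : Integrable (fun x => exp (s * f x)) P := by
  refine ((integrable_const (1:ℝ)).add hi).mono' (by fun_prop) (ae_of_all _ fun x => ?_)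
  rw [Real.norm_of_nonneg (exp_pos _).le]
  simp only [Pi.add_apply]
  rcases le_total 0 (f x) with h | h
  · have : exp (s * f x) ≤ exp (c * f x) := exp_le_exp.2 (by gcongr)
    linarith
  · have : exp (s * f x) ≤ 1 := exp_le_one_iff.2 (mul_nonpos_of_nonneg_of_nonpos hs.le h)
    linarith [exp_pos (c * f x)]

lemma rk_slope {X : Type*} [MeasurableSpace X] {P : Measure X} [IsProbabilityMeasure P]
    {f : X → ℝ} (hf : Measurable f) (hfi : Integrable f P) {c : ℝ} (hc : 0 < c)
    (hi : Integrable (fun x => exp (c * f x)) P) :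
    Tendsto (fun s : ℝ => s⁻¹ * Real.log (∫ x, exp (s * f x) ∂P)) (𝓝[>] 0) (𝓝 (∫ x, f x ∂P)) := by
  have hev : ∀ᶠ s : ℝ in 𝓝[>] 0, s ∈ Ioc 0 c := Ioc_mem_nhdsGT hc
  have h1 : Tendsto (fun s : ℝ => ∫ x, s⁻¹ * (exp (s * f x) - 1) ∂P) (𝓝[>] 0)
      (𝓝 (∫ x, f x ∂P)) := by
    refine tendsto_integral_filter_of_dominated_convergence
      (fun x => |f x| + |c⁻¹ * (exp (c * f x) - 1)|) (Eventually.of_forall fun s => by fun_prop)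
      ?_ ?_ (ae_of_all _ fun x => rk_tendsto_pt (f x))
    · filter_upwards [hev] with s hs
      refine ae_of_all _ fun x => ?_
      rw [Real.norm_eq_abs, abs_le]
      have a1 := rk_exp_lower hs.1 (f x)
      have a2 := rk_exp_upper hs.1 hs.2 (f x)
      constructor
      · linarith [neg_abs_le (f x), abs_nonneg (c⁻¹ * (exp (c * f x) - 1))]
      · linarith [le_abs_self (c⁻¹ * (exp (c * f x) - 1)), abs_nonneg (f x)]
    · exact hfi.abs.add ((hi.sub (integrable_const 1)).const_mul _).abs
  have h2 : HasDerivWithinAt (fun s : ℝ => ∫ x, exp (s * f x) ∂P) (∫ x, f x ∂P) (Ioi 0) 0 := by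
    rw [hasDerivWithinAt_iff_tendsto_slope' (by simp)]
    refine h1.congr' ?_
    filter_upwards [hev] with s hs
    have := rk_integrable_exp hf hs.1 hs.2 hi
    rw [integral_const_mul, integral_sub this (integrable_const 1)]
    simp [slope_def_field, div_eq_inv_mul]
  have h3 := h2.log (by simp)
  rw [hasDerivWithinAt_iff_tendsto_slope' (by simp)] at h3
  simp only [zero_mul, Real.exp_zero, integral_const, probReal_univ, smul_eq_mul, mul_one, div_one] at h3
  refine h3.congr fun s => ?_
  simp [slope_def_field, div_eq_inv_mul]

lemma rk_infinite {X : Type*} [MeasurableSpace X] {P : Measure X} [IsProbabilityMeasure P]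
    {f : X → ℝ} (hf : Measurable f) (hfi : ¬ Integrable f P)
    (hi : Integrable (fun x => exp (- f x)) P) :
    Tendsto (fun s : ℝ => s⁻¹ * (1 - ∫ x, exp (s * (- f x)) ∂P)) (𝓝[>] 0) atTop := by
  have hev : ∀ᶠ s : ℝ in 𝓝[>] 0, s ∈ Ioc 0 (1:ℝ) := Ioc_mem_nhdsGT one_pos
  have hi1 : Integrable (fun x => exp (1 * (- f x))) P := by simpa using hi
  let g : ℝ → X → ℝ := fun s x => (exp (- f x) - 1) - s⁻¹ * (exp (s * (- f x)) - 1)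
  have hgm : ∀ s, Measurable (g s) := fun s => by fun_prop
  have htop : ∫⁻ x, ENNReal.ofReal ((exp (- f x) - 1) - (- f x)) ∂P = ⊤ := by
    by_contra h
    apply hfi
    have : Integrable (fun x => (exp (- f x) - 1) - (- f x)) P :=
      (lintegral_ofReal_ne_top_iff_integrable (by fun_prop)
        (ae_of_all _ fun x => by
          have := Real.add_one_le_exp (- f x)
          simp only [Pi.zero_apply]; linarith)).1 h
    refine (this.sub (hi.sub (integrable_const 1))).congr (ae_of_all _ fun x => ?_)
    simp
  have hF := lintegral_liminf_le (μ := P) (u := 𝓝[>] (0:ℝ)) (f := fun s x => ENNReal.ofReal (g s x))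
    (fun s => (hgm s).ennreal_ofReal)
  have hl : ∀ x, liminf (fun s => ENNReal.ofReal (g s x)) (𝓝[>] (0:ℝ))
      = ENNReal.ofReal ((exp (- f x) - 1) - (- f x)) := fun x =>
    Tendsto.liminf_eq (ENNReal.tendsto_ofReal (tendsto_const_nhds.sub (rk_tendsto_pt (- f x))))
  simp only [hl, htop, top_le_iff] at hF
  have hT : Tendsto (fun s => ∫⁻ x, ENNReal.ofReal (g s x) ∂P) (𝓝[>] (0:ℝ)) (𝓝 ⊤) :=
    tendsto_of_le_liminf_of_limsup_le (by rw [hF]) le_top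
  have hT2 : Tendsto (fun s => ∫ x, g s x ∂P) (𝓝[>] (0:ℝ)) atTop := by
    rw [← ENNReal.tendsto_ofReal_nhds_top]
    refine hT.congr' ?_
    filter_upwards [hev] with s hs
    have := rk_integrable_exp hf.neg hs.1 hs.2 hi1
    refine (ofReal_integral_eq_lintegral_ofReal ?_ ?_).symm
    · exact (hi.sub (integrable_const 1)).sub ((this.sub (integrable_const 1)).const_mul _)
    · refine ae_of_all _ fun x => ?_
      have := rk_exp_upper hs.1 hs.2 (- f x)
      simp only [inv_one, one_mul] at this
      simp only [Pi.zero_apply, g]; linarith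
  have hT3 := tendsto_atTop_add_const_right _ (-(∫ x, exp (- f x) ∂P - 1)) hT2
  refine hT3.congr' ?_
  filter_upwards [hev] with s hs
  have := rk_integrable_exp hf.neg hs.1 hs.2 hi1
  have this' : Integrable (fun x => exp (s * (- f x))) P := this
  have i1 : Integrable (fun x => exp (- f x) - 1) P := hi.sub (integrable_const 1)
  have i2 : Integrable (fun x => s⁻¹ * (exp (s * (- f x)) - 1)) P :=
    (this'.sub (integrable_const 1)).const_mul _
  have e : ∫ x, g s x ∂P = (∫ x, exp (- f x) ∂P - 1) - s⁻¹ * (∫ x, exp (s * (- f x)) ∂P - 1) := by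
    simp only [g]
    rw [integral_sub i1 i2,
      integral_const_mul, integral_sub hi (integrable_const 1), integral_sub this' (integrable_const 1)]
    simp
  rw [e]; ring

section
variable {X : Type*} [MeasurableSpace X] (P Q : Measure X)
    [IsProbabilityMeasure P] [IsProbabilityMeasure Q]

lemma rk_ac_left : P ≪ P + Q := Measure.AbsolutelyContinuous.rfl.add_right Q
lemma rk_ac_right : Q ≪ P + Q := by
  rw [add_comm]; exact Measure.AbsolutelyContinuous.rfl.add_right P

lemma rk_hell (h : P ≪ Q) {a : ℝ} (ha : 0 < a) :
    hellingerInt a P Q = ∫⁻ x, ENNReal.ofReal (exp ((a - 1) * llr P Q x)) ∂P := by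
  have hP := rk_ac_left P Q
  have hQ := rk_ac_right P Q
  have h1 : hellingerInt a P Q = ∫⁻ x, P.rnDeriv (P + Q) x *
      (P.rnDeriv (P + Q) x ^ (a - 1) * Q.rnDeriv (P + Q) x ^ (1 - a)) ∂(P + Q) := by
    refine lintegral_congr_ae ?_
    filter_upwards [Measure.rnDeriv_lt_top P (P + Q)] with x hx
    rcases eq_or_ne (P.rnDeriv (P + Q) x) 0 with h0 | h0
    · simp [h0, ha]
    · rw [← mul_assoc]
      congr 1
      nth_rewrite 2 [← ENNReal.rpow_one (P.rnDeriv (P + Q) x)]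
      rw [← ENNReal.rpow_add _ _ h0 hx.ne]
      congr 1; ring
  rw [h1, lintegral_rnDeriv_mul hP (by fun_prop)]
  refine lintegral_congr_ae ?_
  filter_upwards [hP.ae_le (Measure.rnDeriv_lt_top P (P + Q)), h.ae_le (Measure.rnDeriv_lt_top P Q),
    hP.ae_le (Measure.rnDeriv_lt_top Q (P + Q)), Measure.rnDeriv_pos h, Measure.rnDeriv_pos hP,
    h.ae_le (Measure.rnDeriv_pos hQ), hP.ae_le (Measure.rnDeriv_mul_rnDeriv (κ := P + Q) h)]
    with x p1 r1 q1 r0 p0 q0 he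
  simp only [Pi.mul_apply] at he
  rw [← he, ENNReal.mul_rpow_of_ne_top r1.ne q1.ne, mul_assoc, ← ENNReal.rpow_add _ _ q0.ne' q1.ne]
  have hr : 0 < (P.rnDeriv Q x).toReal := ENNReal.toReal_pos r0.ne' r1.ne
  simp only [sub_add_sub_cancel, sub_self, ENNReal.rpow_zero, mul_one, llr]
  rw [mul_comm, ← Real.rpow_def_of_pos hr, ← ENNReal.ofReal_rpow_of_pos hr,
    ENNReal.ofReal_toReal r1.ne]

lemma rk_hell_real (h : P ≪ Q) {a : ℝ} (ha : 0 < a)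
    (hi : Integrable (fun x => exp ((a - 1) * llr P Q x)) P) :
    hellingerInt a P Q = ENNReal.ofReal (∫ x, exp ((a - 1) * llr P Q x) ∂P) := by
  rw [rk_hell P Q h ha, ofReal_integral_eq_lintegral_ofReal hi (ae_of_all _ fun x => (exp_pos _).le)]

lemma rk_renyi_real (h : P ≪ Q) {a : ℝ} (ha : 0 < a)
    (hi : Integrable (fun x => exp ((a - 1) * llr P Q x)) P) :
    renyiSimple a P Q = (((a - 1)⁻¹ * Real.log (∫ x, exp ((a - 1) * llr P Q x) ∂P) : ℝ) : EReal) := by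
  rw [renyiSimple, rk_hell_real P Q h ha hi, ENNReal.log_ofReal_of_pos (integral_exp_pos hi),
    EReal.coe_mul]

lemma rk_lower {a : ℝ} (ha : a < 1) (hH : hellingerInt a P Q ≠ ⊤) :
    (((1 - a)⁻¹ * (1 - (hellingerInt a P Q).toReal) : ℝ) : EReal) ≤ renyiSimple a P Q := by
  have hneg : (a - 1)⁻¹ < 0 := inv_lt_zero.2 (by linarith)
  rw [renyiSimple]
  rcases eq_or_ne (hellingerInt a P Q) 0 with h0 | h0
  · rw [h0, ENNReal.log_zero, EReal.coe_mul_bot_of_neg hneg]; exact le_top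
  · rw [ENNReal.log_pos_real h0 hH, ← EReal.coe_mul, EReal.coe_le_coe_iff]
    have h1 := Real.log_le_sub_one_of_pos (ENNReal.toReal_pos h0 hH)
    have : (1 - a)⁻¹ = - (a - 1)⁻¹ := by rw [← inv_neg]; congr 1; ring
    rw [this]; nlinarith

lemma rk_exp_neg (h : P ≪ Q) : Integrable (fun x => exp (- llr P Q x)) P :=
  Measure.integrable_toReal_rnDeriv.congr (exp_neg_llr h).symm

lemma rk_sub_tendsto : Tendsto (fun a : ℝ => 1 - a) (𝓝[<] 1) (𝓝[>] 0) := by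
  refine tendsto_nhdsWithin_iff.2 ⟨?_, ?_⟩
  · have : Tendsto (fun a : ℝ => 1 - a) (𝓝 1) (𝓝 (1 - 1)) := (by fun_prop : Continuous fun a : ℝ => 1 - a).tendsto 1
    rw [sub_self] at this
    exact this.mono_left nhdsWithin_le_nhds
  · filter_upwards [self_mem_nhdsWithin] with a ha
    simpa using ha

lemma rk_sub_tendsto' : Tendsto (fun a : ℝ => a - 1) (𝓝[>] 1) (𝓝[>] 0) := by
  refine tendsto_nhdsWithin_iff.2 ⟨?_, ?_⟩
  · have : Tendsto (fun a : ℝ => a - 1) (𝓝 1) (𝓝 (1 - 1)) := (by fun_prop : Continuous fun a : ℝ => a - 1).tendsto 1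
    rw [sub_self] at this
    exact this.mono_left nhdsWithin_le_nhds
  · filter_upwards [self_mem_nhdsWithin] with a ha
    simpa using ha

lemma rk_not_ac (h : ¬ P ≪ Q) : P {x | Q.rnDeriv (P + Q) x = 0} ≠ 0 := by
  intro h0
  apply h
  refine Measure.AbsolutelyContinuous.mk fun A hA hQA => ?_
  have hP := rk_ac_left P Q
  have hQ := rk_ac_right P Q
  have h1 : ∫⁻ x in A, Q.rnDeriv (P + Q) x ∂(P + Q) = 0 := by
    rw [Measure.setLIntegral_rnDeriv hQ]; exact hQA
  rw [setLIntegral_eq_zero_iff hA (by fun_prop)] at h1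
  have h2 := hP.ae_le h1
  have h3 : ∀ᵐ x ∂P, ¬ Q.rnDeriv (P + Q) x = 0 := by
    rw [ae_iff]; simpa using h0
  have : ∀ᵐ x ∂P, x ∉ A := by
    filter_upwards [h2, h3] with x h2 h3 hx using h3 (h2 hx)
  rw [ae_iff] at this
  simpa using this

lemma rk_not_ac_top (h : ¬ P ≪ Q) {a : ℝ} (ha : 1 < a) : hellingerInt a P Q = ⊤ := by
  by_contra hne
  apply rk_not_ac P Q h
  have hP := rk_ac_left P Q
  have h1 := hP.ae_le (ae_lt_top (by fun_prop) hne)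
  have : ∀ᵐ x ∂P, ¬ Q.rnDeriv (P + Q) x = 0 := by
    filter_upwards [h1, Measure.rnDeriv_pos hP] with x hx hp h0
    rw [h0, ENNReal.zero_rpow_of_neg (by linarith), ENNReal.mul_top] at hx
    · exact lt_irrefl _ hx
    · rw [Ne, ENNReal.rpow_eq_zero_iff]
      push Not
      exact ⟨fun h => absurd h hp.ne', fun _ => by linarith⟩
  rw [ae_iff] at this
  simpa using this

lemma rk_young {a : ℝ} (ha : a ∈ Ioo (0:ℝ) 1) :
    hellingerInt a P Q ≤ ENNReal.ofReal a * P {x | Q.rnDeriv (P + Q) x = 0}ᶜ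
      + ENNReal.ofReal (1 - a) := by
  have hP := rk_ac_left P Q
  have hQ := rk_ac_right P Q
  set S := {x | Q.rnDeriv (P + Q) x = 0} with hS
  have hSm : MeasurableSet S := by
    exact measurableSet_eq_fun (Measure.measurable_rnDeriv Q (P + Q)) measurable_const
  have key : hellingerInt a P Q ≤ ∫⁻ x, ENNReal.ofReal a * Sᶜ.indicator (P.rnDeriv (P + Q)) x
      + ENNReal.ofReal (1 - a) * Q.rnDeriv (P + Q) x ∂(P + Q) := by
    refine lintegral_mono_ae ?_
    filter_upwards [Measure.rnDeriv_lt_top P (P + Q), Measure.rnDeriv_lt_top Q (P + Q)] with x hp hq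
    by_cases hx : x ∈ S
    · have : Q.rnDeriv (P + Q) x = 0 := hx
      rw [this, ENNReal.zero_rpow_of_pos (by linarith [ha.2])]
      simp
    · rw [indicator_of_mem (show x ∈ Sᶜ from hx)]
      lift P.rnDeriv (P + Q) x to ℝ≥0 using hp.ne with p
      lift Q.rnDeriv (P + Q) x to ℝ≥0 using hq.ne with q
      have := NNReal.geom_mean_le_arith_mean2_weighted ⟨a, ha.1.le⟩ ⟨1 - a, by linarith [ha.2]⟩ p q
        (by apply NNReal.eq; change a + (1 - a) = 1; ring)
      rw [← ENNReal.coe_rpow_of_nonneg _ ha.1.le, ← ENNReal.coe_rpow_of_nonneg _ (by linarith [ha.2]),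
        ENNReal.ofReal_eq_coe_nnreal ha.1.le, ENNReal.ofReal_eq_coe_nnreal (show 0 ≤ 1 - a by linarith [ha.2])]
      exact_mod_cast this
  refine key.trans (le_of_eq ?_)
  rw [lintegral_add_right _ (by fun_prop),
    lintegral_const_mul _ ((Measure.measurable_rnDeriv _ _).indicator hSm.compl),
    lintegral_const_mul _ (by fun_prop),
    lintegral_indicator hSm.compl,
    Measure.setLIntegral_rnDeriv hP, Measure.lintegral_rnDeriv hQ]
  simp

lemma rk_not_ac_lim (h : ¬ P ≪ Q) :
    Tendsto (fun a : ℝ => renyiSimple a P Q) (𝓝[<] 1) (𝓝 ⊤) := by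
  set c := (P {x | Q.rnDeriv (P + Q) x = 0}ᶜ).toReal with hc
  have hSm : MeasurableSet {x | Q.rnDeriv (P + Q) x = 0} := by
    exact measurableSet_eq_fun (Measure.measurable_rnDeriv Q (P + Q)) measurable_const
  have hc1 : c < 1 := by
    have h1 : P.real {x | Q.rnDeriv (P + Q) x = 0}ᶜ = 1 - P.real {x | Q.rnDeriv (P + Q) x = 0} :=
      probReal_compl_eq_one_sub hSm
    have h2 : 0 < P.real {x | Q.rnDeriv (P + Q) x = 0} :=
      ENNReal.toReal_pos (rk_not_ac P Q h) (measure_ne_top _ _)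
    have : c = P.real {x | Q.rnDeriv (P + Q) x = 0}ᶜ := rfl
    linarith
  have hT : Tendsto (fun a : ℝ => (1 - a)⁻¹ * (a * (1 - c))) (𝓝[<] 1) atTop := by
    refine Tendsto.atTop_mul_pos (C := 1 * (1 - c)) (by linarith)
      (tendsto_inv_nhdsGT_zero.comp rk_sub_tendsto) ?_
    exact ((by fun_prop : Continuous fun a : ℝ => a * (1 - c)).tendsto 1).mono_left nhdsWithin_le_nhds
  refine tendsto_nhds_top_mono (EReal.tendsto_coe_nhds_top_iff.2 hT) ?_
  filter_upwards [Ioo_mem_nhdsLT (zero_lt_one' ℝ)] with a ha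
  have hy := rk_young P Q ha
  have hfin : ENNReal.ofReal a * P {x | Q.rnDeriv (P + Q) x = 0}ᶜ + ENNReal.ofReal (1 - a) ≠ ⊤ := by
    finiteness
  refine le_trans ?_ (rk_lower P Q ha.2 (ne_top_of_le_ne_top hfin hy))
  rw [EReal.coe_le_coe_iff]
  have h1 := ENNReal.toReal_mono hfin hy
  rw [ENNReal.toReal_add (by finiteness) (by finiteness), ENNReal.toReal_mul,
    ENNReal.toReal_ofReal ha.1.le, ENNReal.toReal_ofReal (by linarith [ha.2]), ← hc] at h1
  have : 0 < (1 - a)⁻¹ := inv_pos.2 (by linarith [ha.2])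
  gcongr
  linarith

lemma rk_below : Tendsto (fun a : ℝ => renyiSimple a P Q) (𝓝[<] 1) (𝓝 (klDiv P Q)) := by
  by_cases h : P ≪ Q
  swap
  · rw [klDiv, if_neg (fun h' => h h'.1)]; exact rk_not_ac_lim P Q h
  have hm : Measurable (llr P Q) := measurable_llr P Q
  have hi := rk_exp_neg P Q h
  have hi1 : Integrable (fun x => exp (1 * (- llr P Q x))) P := by simpa using hi
  have he : ∀ (a : ℝ) x, (a - 1) * llr P Q x = (1 - a) * (- llr P Q x) := fun a x => by ring
  have hia : ∀ a ∈ Ioo (0:ℝ) 1, Integrable (fun x => exp ((a - 1) * llr P Q x)) P := by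
    intro a ha
    simp only [he]
    exact rk_integrable_exp hm.neg (by linarith [ha.2]) (by linarith [ha.1]) hi1
  by_cases hf : Integrable (llr P Q) P
  · rw [klDiv, if_pos ⟨h, hf⟩]
    have hs := ((rk_slope hm.neg hf.neg one_pos hi1).comp rk_sub_tendsto).neg
    simp only [Pi.neg_apply, integral_neg, neg_neg] at hs
    refine (EReal.tendsto_coe.2 hs).congr' ?_
    filter_upwards [Ioo_mem_nhdsLT (zero_lt_one' ℝ)] with a ha
    rw [rk_renyi_real P Q h ha.1 (hia a ha), EReal.coe_eq_coe_iff]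
    simp only [Function.comp, he]
    rw [← neg_mul, ← inv_neg, neg_sub]
  · rw [klDiv, if_neg (fun h' => hf h'.2)]
    have hT := (rk_infinite hm hf hi).comp rk_sub_tendsto
    refine tendsto_nhds_top_mono (EReal.tendsto_coe_nhds_top_iff.2 hT) ?_
    filter_upwards [Ioo_mem_nhdsLT (zero_lt_one' ℝ)] with a ha
    have hH := rk_hell_real P Q h ha.1 (hia a ha)
    refine le_trans (le_of_eq ?_) (rk_lower P Q ha.2 (by rw [hH]; finiteness))
    rw [hH, ENNReal.toReal_ofReal (integral_exp_pos (hia a ha)).le]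
    simp only [Function.comp, he]

lemma rk_exp_int (h : P ≪ Q) {a : ℝ} (ha : 1 < a) (hH : hellingerInt a P Q ≠ ⊤) :
    Integrable (fun x => exp ((a - 1) * llr P Q x)) P := by
  have hm : Measurable (llr P Q) := measurable_llr P Q
  rw [rk_hell P Q h (by linarith)] at hH
  exact (lintegral_ofReal_ne_top_iff_integrable (by fun_prop) (ae_of_all _ fun x => (exp_pos _).le)).1 hH

lemma rk_int_of_exp (h : P ≪ Q) {c : ℝ} (hc : 0 < c)
    (hi : Integrable (fun x => exp (c * llr P Q x)) P) : Integrable (llr P Q) P := by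
  have hm : Measurable (llr P Q) := measurable_llr P Q
  refine ((rk_exp_neg P Q h).add (hi.const_mul c⁻¹)).mono' (by fun_prop) (ae_of_all _ fun x => ?_)
  have h1 := rk_exp_lower hc (llr P Q x)
  have h2 := Real.add_one_le_exp (- llr P Q x)
  have h3 := exp_pos (- llr P Q x)
  have h4 := exp_pos (c * llr P Q x)
  have h5 : 0 < c⁻¹ := inv_pos.2 hc
  have h6 : 0 < c⁻¹ * exp (c * llr P Q x) := by positivity
  rw [mul_sub] at h1
  simp only [Pi.add_apply]
  rw [Real.norm_eq_abs, abs_le]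
  constructor <;> linarith

lemma rk_renyi_top {a : ℝ} (ha : 1 < a) (hH : hellingerInt a P Q = ⊤) : renyiSimple a P Q = ⊤ := by
  rw [renyiSimple, hH, ENNReal.log_top, EReal.coe_mul_top_of_pos (inv_pos.2 (by linarith))]

lemma rk_above (hyp : klDiv P Q = ⊤ ∨ ∃ β : ℝ, 1 < β ∧ renyiSimple β P Q < ⊤) :
    Tendsto (fun a : ℝ => renyiSimple a P Q) (𝓝[>] 1) (𝓝 (klDiv P Q)) := by
  by_cases hk : P ≪ Q ∧ Integrable (llr P Q) P
  · obtain ⟨h, hf⟩ := hk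
    rw [klDiv, if_pos ⟨h, hf⟩] at hyp ⊢
    rcases hyp with hyp | ⟨β, hβ, hlt⟩
    · exact absurd hyp (EReal.coe_ne_top _)
    have hH : hellingerInt β P Q ≠ ⊤ := fun hH => hlt.ne (rk_renyi_top P Q hβ hH)
    have hm : Measurable (llr P Q) := measurable_llr P Q
    have hi := rk_exp_int P Q h hβ hH
    have hs := (rk_slope hm hf (by linarith) hi).comp rk_sub_tendsto'
    refine (EReal.tendsto_coe.2 hs).congr' ?_
    filter_upwards [Ioo_mem_nhdsGT hβ] with a ha
    rw [rk_renyi_real P Q h (by linarith [ha.1])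
      (rk_integrable_exp hm (by linarith [ha.1]) (by linarith [ha.2]) hi)]
    rfl
  · rw [klDiv, if_neg hk]
    refine tendsto_const_nhds.congr' ?_
    filter_upwards [self_mem_nhdsWithin] with a ha
    have ha : 1 < a := ha
    refine (rk_renyi_top P Q ha ?_).symm
    by_cases h : P ≪ Q
    · by_contra hH
      exact hk ⟨h, rk_int_of_exp P Q h (by linarith) (rk_exp_int P Q h ha hH)⟩
    · exact rk_not_ac_top P Q h ha

end

/-- **Order 1.** The Rényi divergence tends to the Kullback-Leibler divergence as the
order tends to `1` from below (so `D_1(P‖Q) = D(P‖Q)`); moreover, if `D(P‖Q) = ∞` or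
there is a `β > 1` with `D_β(P‖Q) < ∞`, then the limit from above is also `D(P‖Q)`. -/
theorem renyiDiv_tendsto_klDiv_at_one
    {X : Type*} [MeasurableSpace X] (P Q : Measure X)
    [IsProbabilityMeasure P] [IsProbabilityMeasure Q] :
    Tendsto (fun a : ℝ => renyiSimple a P Q) (nhdsWithin 1 (Set.Iio 1))
        (nhds (klDiv P Q)) ∧
    renyiDiv 1 P Q = klDiv P Q ∧
    ((klDiv P Q = ⊤ ∨ ∃ β : ℝ, 1 < β ∧ renyiSimple β P Q < ⊤) →
      Tendsto (fun a : ℝ => renyiSimple a P Q) (nhdsWithin 1 (Set.Ioi 1))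
        (nhds (klDiv P Q))) := by
  refine ⟨rk_below P Q, ?_, rk_above P Q⟩
  rw [renyiDiv, if_neg one_ne_zero, if_pos rfl]
  exact (rk_below P Q).limsup_eq
end

section
/- For any probability measures P and Q on a measurable space (X, 𝓐) with densities p, q with respect to a common σ-finite dominating measure μ, the Rényi divergence of order ∞ has the closed form D_∞(P‖Q) = log sup_{A ∈ 𝓐} P(A)/Q(A) = log(ess sup_P (p/q)), where ess sup_P X = sup{c : P(X > c) > 0} denotes the essential supremum with respect to P, and the conventions 0/0 = 0 and x/0 = ∞ for x > 0 are used. -/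
open MeasureTheory Real Filter Set
open scoped ENNReal NNReal Topology Classical

theorem essSup_div_aux {X : Type*} [MeasurableSpace X] (P Q : Measure X)
    [IsProbabilityMeasure P] [IsProbabilityMeasure Q]
    (μ : Measure X) [SigmaFinite μ] (p q : X → ℝ≥0∞)
    (hp : Measurable p) (hq : Measurable q)
    (hP : P = μ.withDensity p) (hQ : Q = μ.withDensity q) :
    essSup (fun x => p x / q x) P = ⨆ (A : Set X) (_ : MeasurableSet A), P A / Q A := by
  have hPA : ∀ A, MeasurableSet A → P A = ∫⁻ x in A, p x ∂μ := fun A hA => by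
    rw [hP, withDensity_apply _ hA]
  have hQA : ∀ A, MeasurableSet A → Q A = ∫⁻ x in A, q x ∂μ := fun A hA => by
    rw [hQ, withDensity_apply _ hA]
  apply le_antisymm
  · set S := ⨆ (A : Set X) (_ : MeasurableSet A), P A / Q A with hS
    by_cases hST : S = ⊤
    · rw [hST]; exact le_top
    have h1 : ∀ A, MeasurableSet A → P A ≤ S * Q A := fun A hA => by
      have : P A / Q A ≤ S := le_iSup₂ (f := fun (A : Set X) (_ : MeasurableSet A) => P A / Q A) A hA
      exact (ENNReal.div_le_iff_le_mul (Or.inr hST) (Or.inl (measure_ne_top Q A))).1 this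
    have h2 : p ≤ᵐ[μ] fun x => S * q x := by
      apply ae_le_of_forall_setLIntegral_le_of_sigmaFinite hp
      intro A hA _
      rw [lintegral_const_mul _ hq, ← hPA A hA, ← hQA A hA]
      exact h1 A hA
    have h3 : ∀ᵐ x ∂P, p x / q x ≤ S := by
      have hac : P ≪ μ := by rw [hP]; exact withDensity_absolutelyContinuous _ _
      apply hac.ae_le
      filter_upwards [h2] with x hx
      exact ENNReal.div_le_of_le_mul hx
    exact essSup_le_of_ae_le _ h3
  · set E := essSup (fun x => p x / q x) P with hE
    by_cases hET : E = ⊤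
    · rw [hET]; exact le_top
    have h3 : ∀ᵐ x ∂P, p x / q x ≤ E := ENNReal.ae_le_essSup _
    rw [hP, ae_withDensity_iff hp] at h3
    have h4 : ∀ᵐ x ∂μ, q x < ⊤ := by
      apply ae_lt_top hq
      rw [← setLIntegral_univ, ← hQA _ MeasurableSet.univ]
      exact measure_ne_top _ _
    have h5 : ∀ᵐ x ∂μ, p x ≤ E * q x := by
      filter_upwards [h3, h4] with x hx hx'
      by_cases h0 : p x = 0
      · rw [h0]; exact zero_le
      · exact (ENNReal.div_le_iff_le_mul (Or.inr hET) (Or.inl hx'.ne)).1 (hx h0)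
    refine iSup₂_le fun A hA => ENNReal.div_le_of_le_mul ?_
    rw [hPA A hA, hQA A hA, ← lintegral_const_mul _ hq]
    exact lintegral_mono_ae (ae_restrict_of_ae h5)

theorem renyi_limsup_aux {X : Type*} [MeasurableSpace X] (P : Measure X)
    [IsProbabilityMeasure P] (r : X → ℝ≥0∞) (hr : Measurable r) :
    Filter.limsup (fun a : ℝ => ENNReal.log ((∫⁻ x, r x ^ (a - 1) ∂P) ^ (a - 1)⁻¹)) Filter.atTop
      = ENNReal.log (essSup r P) := by
  apply le_antisymm
  · apply Filter.limsup_le_of_le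
    · isBoundedDefault
    filter_upwards [eventually_gt_atTop (1:ℝ)] with a ha
    have ha' : 0 < a - 1 := by linarith
    apply ENNReal.log_monotone
    rw [ENNReal.rpow_inv_le_iff ha']
    calc ∫⁻ x, r x ^ (a - 1) ∂P ≤ ∫⁻ x, (essSup r P) ^ (a - 1) ∂P := by
          apply lintegral_mono_ae
          filter_upwards [ENNReal.ae_le_essSup (μ := P) r] with x hx
          exact ENNReal.rpow_le_rpow hx ha'.le
      _ = _ := by simp
  · set L := Filter.limsup (fun a : ℝ => ENNReal.log ((∫⁻ x, r x ^ (a - 1) ∂P) ^ (a - 1)⁻¹)) Filter.atTop with hL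
    suffices h : essSup r P ≤ EReal.exp L by
      calc _ ≤ ENNReal.log (EReal.exp L) := ENNReal.log_monotone h
        _ = L := EReal.log_exp L
    apply le_of_forall_lt
    intro c₀ hc₀
    obtain ⟨c, hc0, hc⟩ := exists_between hc₀
    refine lt_of_lt_of_le hc0 ?_
    have hcT : c ≠ ⊤ := (hc.trans_le le_top).ne
    have hm : P {x | c ≤ r x} ≠ 0 := by
      intro h
      have : ∀ᵐ x ∂P, r x ≤ c := by
        have h' : ∀ᵐ x ∂P, ¬ (c ≤ r x) := by
          rw [ae_iff]; simpa using h
        filter_upwards [h'] with x hx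
        exact (not_le.1 hx).le
      exact absurd (essSup_le_of_ae_le _ this) (not_le.2 hc)
    set m := P {x | c ≤ r x} with hmdef
    have hmT : m ≠ ⊤ := measure_ne_top _ _
    have hlow : ∀ᶠ a : ℝ in atTop, ENNReal.log (c * m ^ (a - 1)⁻¹) ≤
        ENNReal.log ((∫⁻ x, r x ^ (a - 1) ∂P) ^ (a - 1)⁻¹) := by
      filter_upwards [eventually_gt_atTop (1:ℝ)] with a ha
      have ha' : 0 < a - 1 := by linarith
      apply ENNReal.log_monotone
      rw [ENNReal.le_rpow_inv_iff ha', ENNReal.mul_rpow_of_nonneg _ _ ha'.le,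
        ENNReal.rpow_inv_rpow ha'.ne']
      calc c ^ (a-1) * m ≤ c ^ (a-1) * P {x | c ^ (a-1) ≤ r x ^ (a-1)} := by
            gcongr
            exact measure_mono fun x hx => ENNReal.rpow_le_rpow hx ha'.le
        _ ≤ _ := mul_meas_ge_le_lintegral (hr.pow_const _) _
    have ht : Tendsto (fun a : ℝ => ENNReal.log (c * m ^ (a - 1)⁻¹)) atTop (𝓝 (ENNReal.log c)) := by
      apply (ENNReal.continuous_log.tendsto _).comp
      have h1 : Tendsto (fun a : ℝ => (a - 1)⁻¹) atTop (𝓝 0) :=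
        tendsto_inv_atTop_zero.comp (tendsto_atTop_add_const_right _ (-1) tendsto_id)
      have h2 : Tendsto (fun a : ℝ => m ^ (a - 1)⁻¹) atTop (𝓝 1) := by
        lift m to ℝ≥0 using hmT with m'
        have hm0 : m' ≠ 0 := by simpa using hm
        have h3 : Tendsto (fun a : ℝ => m' ^ (a - 1)⁻¹) atTop (𝓝 (m' ^ (0:ℝ))) :=
          ((NNReal.continuousAt_rpow (Or.inl hm0)).tendsto (x := (m', (0:ℝ)))).comp
            (tendsto_const_nhds.prodMk_nhds h1)
        rw [NNReal.rpow_zero] at h3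
        have h4 := ENNReal.tendsto_coe.2 h3
        simpa [ENNReal.coe_rpow_of_ne_zero hm0] using h4
      simpa using ENNReal.Tendsto.const_mul h2 (Or.inr hcT)
    have h6 : ENNReal.log c ≤ L := by
      rw [← ht.limsup_eq]
      exact Filter.limsup_le_limsup hlow
    calc c = EReal.exp (ENNReal.log c) := (ENNReal.exp_log c).symm
      _ ≤ _ := EReal.exp_monotone h6

theorem renyiDiv_top_aux {X : Type*} [MeasurableSpace X] (P Q : Measure X)
    [IsProbabilityMeasure P] [IsProbabilityMeasure Q] :
    renyiDiv ⊤ P Q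
        = ENNReal.log (⨆ (A : Set X) (_ : MeasurableSet A), P A / Q A) := by
  have hf : Measurable (P.rnDeriv (P + Q)) := Measure.measurable_rnDeriv _ _
  have hg : Measurable (Q.rnDeriv (P + Q)) := Measure.measurable_rnDeriv _ _
  have hP : P = (P + Q).withDensity (P.rnDeriv (P + Q)) :=
    (Measure.withDensity_rnDeriv_eq _ _ (Measure.AbsolutelyContinuous.rfl.add_right Q)).symm
  have hQ : Q = (P + Q).withDensity (Q.rnDeriv (P + Q)) := by
    refine (Measure.withDensity_rnDeriv_eq _ _ ?_).symm
    rw [add_comm]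
    exact (Measure.AbsolutelyContinuous.rfl.add_right P)
  rw [← essSup_div_aux P Q (P + Q) _ _ hf hg hP hQ, 
    ← renyi_limsup_aux P (fun x => P.rnDeriv (P + Q) x / Q.rnDeriv (P + Q) x) (hf.div hg)]
  have hR : renyiDiv ⊤ P Q = Filter.limsup (fun a : ℝ => renyiSimple a P Q) Filter.atTop := by
    simp [renyiDiv]
  rw [hR]
  apply Filter.limsup_congr
  filter_upwards [eventually_gt_atTop (1:ℝ)] with a ha
  have ha' : 0 < a - 1 := by linarith
  have hH : hellingerInt a P Q
      = ∫⁻ x, (P.rnDeriv (P + Q) x / Q.rnDeriv (P + Q) x) ^ (a - 1) ∂P := by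
    have h1 : ∫⁻ x, (P.rnDeriv (P + Q) x / Q.rnDeriv (P + Q) x) ^ (a - 1) ∂P
      = ∫⁻ x, (P.rnDeriv (P + Q) x / Q.rnDeriv (P + Q) x) ^ (a - 1)
        ∂((P + Q).withDensity (P.rnDeriv (P + Q))) := by rw [← hP]
    have hm : Measurable
        (fun x => (P.rnDeriv (P + Q) x / Q.rnDeriv (P + Q) x) ^ (a - 1)) :=
      (hf.div hg).pow_const _
    rw [h1, lintegral_withDensity_eq_lintegral_mul _ hf hm]
    unfold hellingerInt
    apply lintegral_congr
    intro x
    simp only [Pi.mul_apply]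
    generalize P.rnDeriv (P + Q) x = u
    generalize Q.rnDeriv (P + Q) x = v
    rw [div_eq_mul_inv, ENNReal.mul_rpow_of_nonneg _ _ ha'.le, ENNReal.inv_rpow,
      ← ENNReal.rpow_neg, ← mul_assoc]
    congr 1
    · conv_rhs => rw [← ENNReal.rpow_one u, ← ENNReal.rpow_mul, one_mul,
        ← ENNReal.rpow_add_of_nonneg _ _ zero_le_one ha'.le]
      congr 1; ring
    · congr 1; ring
  rw [renyiSimple, hH, ENNReal.log_rpow]

/-- **Order ∞.** For probability measures `P, Q` with densities `p, q` with respect to a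
common σ-finite dominating measure `μ`, the Rényi divergence of order `∞` has the closed
forms `D_∞(P‖Q) = log sup_{A ∈ 𝓐} P(A)/Q(A) = log (ess sup_P p/q)`, where the `ℝ≥0∞`-valued
division implements the conventions `0/0 = 0` and `x/0 = ∞` for `x > 0`. -/
theorem renyiDiv_top_eq_log_essSup
    {X : Type*} [MeasurableSpace X] (P Q : Measure X)
    [IsProbabilityMeasure P] [IsProbabilityMeasure Q]
    (μ : Measure X) [SigmaFinite μ] (p q : X → ℝ≥0∞)
    (hp : Measurable p) (hq : Measurable q)
    (hP : P = μ.withDensity p) (hQ : Q = μ.withDensity q) :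
    renyiDiv ⊤ P Q
        = ENNReal.log (⨆ (A : Set X) (_ : MeasurableSet A), P A / Q A) ∧
    renyiDiv ⊤ P Q
        = ENNReal.log (essSup (fun x => p x / q x) P) := by
  have h := renyiDiv_top_aux P Q
  refine ⟨h, ?_⟩
  rw [h, essSup_div_aux P Q μ p q hp hq hP hQ]
end

section
/- For any order α ∈ [0,∞] and any probability measures P, Q on a measurable space (X, 𝓐), D_α(P‖Q) = sup_𝒫 D_α(P|𝒫 ‖ Q|𝒫), where the supremum is over all finite measurable partitions 𝒫 ⊆ 𝓐 of X and P|𝒫 denotes the restriction of P to the finite σ-algebra generated by 𝒫 (so that, for simple orders α, D_α(P|𝒫 ‖ Q|𝒫) = (α−1)⁻¹ log ∑_{A∈𝒫} P(A)^α Q(A)^{1−α}). -/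
open MeasureTheory Real Filter Set
open scoped ENNReal NNReal Topology Classical

namespace RenyiAux

section basic
set_option linter.unusedSectionVars false
variable {X : Type*} {m0 : MeasurableSpace X} (P Q : Measure X) [IsFiniteMeasure P] [IsFiniteMeasure Q]

lemma acL : P ≪ P + Q := Measure.absolutelyContinuous_of_le (Measure.le_add_right le_rfl)
lemma acR : Q ≪ P + Q := Measure.absolutelyContinuous_of_le (Measure.le_add_left le_rfl)

lemma setP {s : Set X} (hs : MeasurableSet s) :
    ∫⁻ x in s, P.rnDeriv (P + Q) x ∂(P + Q) = P s :=
  Measure.setLIntegral_rnDeriv' (acL P Q) hs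
lemma setQ {s : Set X} (hs : MeasurableSet s) :
    ∫⁻ x in s, Q.rnDeriv (P + Q) x ∂(P + Q) = Q s :=
  Measure.setLIntegral_rnDeriv' (acR P Q) hs

lemma add_one : ∀ᵐ x ∂(P + Q), P.rnDeriv (P + Q) x + Q.rnDeriv (P + Q) x = 1 := by
  filter_upwards [Measure.rnDeriv_add' P Q (P + Q), Measure.rnDeriv_self (P + Q)] with x h1 h2
  rw [← h2, h1]; rfl

/-- interpolation inequality -/
lemma interp (a b r : ℝ) (hr0 : 0 < r) (hr1 : r < 1) (ha : 0 < a) (hb : 0 < b)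
    (hab : 1 - b = r * (1 - a)) [IsProbabilityMeasure P] :
    hellingerInt b P Q ≤ hellingerInt a P Q ^ r := by
  have hP : ∫⁻ x, P.rnDeriv (P + Q) x ∂(P + Q) = 1 := by
    rw [Measure.lintegral_rnDeriv (acL P Q)]; simp
  have h := ENNReal.lintegral_mul_norm_pow_le (μ := P + Q)
    (f := fun x => P.rnDeriv (P + Q) x ^ a * Q.rnDeriv (P + Q) x ^ (1 - a))
    (g := fun x => P.rnDeriv (P + Q) x) (by fun_prop) (by fun_prop) (p := r) (q := 1 - r)
    hr0.le (by linarith) (by ring)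
  rw [hP, ENNReal.one_rpow, mul_one] at h
  refine le_trans (le_of_eq ?_) h
  unfold hellingerInt
  refine lintegral_congr_ae ?_
  filter_upwards [add_one P Q] with x hx
  have hp : P.rnDeriv (P + Q) x ≠ ∞ := by
    intro h; simp [h] at hx
  generalize P.rnDeriv (P + Q) x = p at *
  generalize Q.rnDeriv (P + Q) x = q at *
  rcases eq_or_ne p 0 with rfl | hp0
  · rw [ENNReal.zero_rpow_of_pos ha, ENNReal.zero_rpow_of_pos hb]
    simp [hr0]
  · rw [ENNReal.mul_rpow_of_nonneg _ _ hr0.le, ← ENNReal.rpow_mul, ← ENNReal.rpow_mul,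
      mul_right_comm, ← ENNReal.rpow_add _ _ hp0 hp]
    congr 2 <;> linarith

lemma renyi_mono_lt {a b : ℝ} (ha : 0 < a) (hab : a < b) (hb : b < 1) [IsProbabilityMeasure P] :
    renyiSimple a P Q ≤ renyiSimple b P Q := by
  have ha1 : 0 < 1 - a := by linarith
  have hb1 : 0 < 1 - b := by linarith
  have h := interp P Q a b ((1 - b) / (1 - a)) (by positivity)
    (by rw [div_lt_one ha1]; linarith) ha (by linarith) (by field_simp)
  have h2 := ENNReal.log_le_log h
  rw [ENNReal.log_rpow] at h2
  unfold renyiSimple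
  have e : (((a - 1)⁻¹ : ℝ) : EReal) = (((b - 1)⁻¹ : ℝ) : EReal) * (((1 - b) / (1 - a) : ℝ) : EReal) := by
    rw [← EReal.coe_mul]
    congr 1
    have : a - 1 ≠ 0 := by linarith
    have : b - 1 ≠ 0 := by linarith
    field_simp
    ring
  rw [e, mul_assoc]
  have hc : (((b - 1)⁻¹ : ℝ) : EReal) ≤ 0 := by
    rw [EReal.coe_nonpos, inv_nonpos]; linarith
  rw [mul_comm, mul_comm _ (ENNReal.log (hellingerInt b P Q))]
  exact EReal.mul_le_mul_of_nonpos_right h2 hc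

lemma renyi_mono_gt {a b : ℝ} (ha : 1 < a) (hab : a < b) [IsProbabilityMeasure P] :
    renyiSimple a P Q ≤ renyiSimple b P Q := by
  have ha1 : 0 < a - 1 := by linarith
  have hb1 : 0 < b - 1 := by linarith
  have h := interp P Q b a ((a - 1) / (b - 1)) (by positivity)
    (by rw [div_lt_one hb1]; linarith) (by linarith) (by linarith) (by field_simp; ring)
  have h2 := ENNReal.log_le_log h
  rw [ENNReal.log_rpow] at h2
  unfold renyiSimple
  have e : (((b - 1)⁻¹ : ℝ) : EReal) = (((a - 1)⁻¹ : ℝ) : EReal) * (((a - 1) / (b - 1) : ℝ) : EReal) := by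
    rw [← EReal.coe_mul]
    congr 1
    field_simp
  rw [e, mul_assoc]
  have hc : 0 ≤ (((a - 1)⁻¹ : ℝ) : EReal) := by
    rw [EReal.coe_nonneg, inv_nonneg]; linarith
  gcongr

/-- data processing on a cell, order < 1 -/
lemma cell_lt {α : ℝ} (h0 : 0 < α) (h1 : α < 1) {A : Set X} (hA : MeasurableSet A) :
    ∫⁻ x in A, P.rnDeriv (P + Q) x ^ α * Q.rnDeriv (P + Q) x ^ (1 - α) ∂(P + Q)
      ≤ P A ^ α * Q A ^ (1 - α) := by
  have h := ENNReal.lintegral_mul_norm_pow_le (μ := (P + Q).restrict A)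
    (f := fun x => P.rnDeriv (P + Q) x)
    (g := fun x => Q.rnDeriv (P + Q) x) (by fun_prop) (by fun_prop) (p := α) (q := 1 - α)
    h0.le (by linarith) (by ring)
  rwa [setP P Q hA, setQ P Q hA] at h

lemma cell_gt {α : ℝ} (h1 : 1 < α) {A : Set X} (hA : MeasurableSet A) :
    P A ^ α * Q A ^ (1 - α) ≤
    ∫⁻ x in A, P.rnDeriv (P + Q) x ^ α * Q.rnDeriv (P + Q) x ^ (1 - α) ∂(P + Q) := by
  have h0 : 0 < α := by linarith
  set I := ∫⁻ x in A, P.rnDeriv (P + Q) x ^ α * Q.rnDeriv (P + Q) x ^ (1 - α) ∂(P + Q) with hI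
  by_cases hIt : I = ∞
  · rw [hIt]; exact le_top
  have hfin := ae_lt_top (by fun_prop) hIt
  have h := ENNReal.lintegral_mul_norm_pow_le (μ := (P + Q).restrict A)
    (f := fun x => P.rnDeriv (P + Q) x ^ α * Q.rnDeriv (P + Q) x ^ (1 - α))
    (g := fun x => Q.rnDeriv (P + Q) x) (by fun_prop) (by fun_prop) (p := α⁻¹) (q := 1 - α⁻¹)
    (by positivity) (by rw [sub_nonneg]; exact inv_le_one_of_one_le₀ h1.le) (by ring)
  rw [setQ P Q hA, ← hI] at h
  have e : ∫⁻ x in A, (P.rnDeriv (P + Q) x ^ α * Q.rnDeriv (P + Q) x ^ (1 - α)) ^ α⁻¹ *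
      Q.rnDeriv (P + Q) x ^ (1 - α⁻¹) ∂(P + Q) = P A := by
    rw [← setP P Q hA]
    refine lintegral_congr_ae ?_
    filter_upwards [hfin, ae_restrict_of_ae (add_one P Q)] with x hx hx1
    have hq : Q.rnDeriv (P + Q) x ≠ ∞ := by
      intro h; simp [h] at hx1
    generalize P.rnDeriv (P + Q) x = p at *
    generalize Q.rnDeriv (P + Q) x = q at *
    rcases eq_or_ne q 0 with rfl | hq0
    · have : p = 0 := by
        by_contra hp
        rw [ENNReal.zero_rpow_of_neg (by linarith), ENNReal.mul_top] at hx
        · exact lt_irrefl _ hx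
        · simp [ENNReal.rpow_eq_zero_iff, hp, h0.not_gt]
      subst this
      simp at hx1
    · rw [ENNReal.mul_rpow_of_nonneg _ _ (by positivity), ← ENNReal.rpow_mul, ← ENNReal.rpow_mul,
        mul_assoc, ← ENNReal.rpow_add _ _ hq0 hq, mul_inv_cancel₀ h0.ne', ENNReal.rpow_one]
      have : (1 - α) * α⁻¹ + (1 - α⁻¹) = 0 := by field_simp; ring
      rw [this]; simp
  rw [e] at h
  have h' := ENNReal.rpow_le_rpow h h0.le
  rw [ENNReal.mul_rpow_of_nonneg _ _ h0.le, ← ENNReal.rpow_mul, ← ENNReal.rpow_mul,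
    inv_mul_cancel₀ h0.ne', ENNReal.rpow_one] at h'
  have e2 : (1 - α⁻¹) * α = α - 1 := by field_simp
  rw [e2] at h'
  rcases eq_or_ne (Q A) 0 with hq | hq
  · rw [hq, ENNReal.zero_rpow_of_pos (by linarith), mul_zero] at h'
    rw [nonpos_iff_eq_zero.1 h']; simp
  · calc P A ^ α * Q A ^ (1 - α) ≤ I * Q A ^ (α - 1) * Q A ^ (1 - α) := by gcongr
      _ = I := by
        rw [mul_assoc, ← ENNReal.rpow_add _ _ hq (measure_ne_top _ _)]
        simp

lemma hell_sum (α : ℝ) (prt : Finset (Set X)) (h : ∀ A ∈ (prt : Set (Set X)), MeasurableSet A)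
    (hd : (prt : Set (Set X)).PairwiseDisjoint id) (hu : ⋃₀ (prt : Set (Set X)) = Set.univ) :
    hellingerInt α P Q = ∑ A ∈ prt, ∫⁻ x in A,
      P.rnDeriv (P + Q) x ^ α * Q.rnDeriv (P + Q) x ^ (1 - α) ∂(P + Q) := by
  have := lintegral_biUnion_finset (μ := P + Q) (t := id) hd h
    (fun x => P.rnDeriv (P + Q) x ^ α * Q.rnDeriv (P + Q) x ^ (1 - α))
  simp only [id] at this
  rw [← this, hellingerInt]
  have e : ⋃ b ∈ prt, b = (Set.univ : Set X) := by
    rw [← hu, Set.sUnion_eq_biUnion]; simp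
  rw [e, Measure.restrict_univ]

end basic

lemma const_on {X : Type*} {prt : Set (Set X)} (hd : prt.PairwiseDisjoint id)
    {A : Set X} (hA : A ∈ prt) {s : Set X}
    (hs : MeasurableSet[MeasurableSpace.generateFrom prt] s) : A ⊆ s ∨ A ⊆ sᶜ := by
  induction s, hs using MeasurableSpace.generateFrom_induction with
  | hC t ht _ =>
    by_cases hAt : A = t
    · left; rw [hAt]
    · right; exact (hd hA ht hAt).subset_compl_right
  | empty => right; simp
  | compl t _ ih => rw [compl_compl]; exact ih.symm
  | iUnion f _ ih =>
    by_cases hh : ∃ n, A ⊆ f n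
    · obtain ⟨n, hn⟩ := hh
      left; exact hn.trans (Set.subset_iUnion f n)
    · right
      push Not at hh
      rw [Set.compl_iUnion]
      exact Set.subset_iInter fun n => (ih n).resolve_left (hh n)

lemma const_fun {X : Type*} {prt : Set (Set X)} (hd : prt.PairwiseDisjoint id)
    {A : Set X} (hA : A ∈ prt) {f : X → ℝ≥0∞}
    (hf : Measurable[MeasurableSpace.generateFrom prt] f) :
    ∃ c, ∀ x ∈ A, f x = c := by
  rcases A.eq_empty_or_nonempty with rfl | ⟨y, hy⟩
  · exact ⟨0, by simp⟩
  · refine ⟨f y, fun x hx => ?_⟩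
    have := const_on hd hA (hf (measurableSet_singleton (f y)))
    rcases this with h | h
    · exact h hx
    · exact absurd rfl (h hy)

lemma cell_eq {X : Type*} {prt : Set (Set X)} (hd : prt.PairwiseDisjoint id)
    {A : Set X} (hA : A ∈ prt) {α : ℝ} (h0 : 0 < α)
    (P Q : @Measure X (MeasurableSpace.generateFrom prt))
    [IsFiniteMeasure P] [IsFiniteMeasure Q] :
    ∫⁻ x in A, P.rnDeriv (P + Q) x ^ α * Q.rnDeriv (P + Q) x ^ (1 - α) ∂(P + Q)
      = P A ^ α * Q A ^ (1 - α) := by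
  let _ := MeasurableSpace.generateFrom prt
  have hAm : MeasurableSet A := MeasurableSpace.measurableSet_generateFrom hA
  obtain ⟨c, hc⟩ := const_fun hd hA (Measure.measurable_rnDeriv P (P + Q))
  obtain ⟨d, hdd⟩ := const_fun hd hA (Measure.measurable_rnDeriv Q (P + Q))
  have hP := setP P Q hAm
  have hQ := setQ P Q hAm
  rw [setLIntegral_congr_fun hAm (g := fun _ => c) hc, setLIntegral_const] at hP
  rw [setLIntegral_congr_fun hAm (g := fun _ => d) hdd, setLIntegral_const] at hQ
  rw [setLIntegral_congr_fun hAm (g := fun _ => c ^ α * d ^ (1 - α))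
    (fun x hx => by simp only [hc x hx, hdd x hx]), setLIntegral_const, ← hP, ← hQ]
  have ht : (P + Q) A ≠ ∞ := measure_ne_top _ _
  generalize (P + Q) A = μ at *
  rcases eq_or_ne μ 0 with rfl | hμ
  · simp [h0]
  · rw [ENNReal.mul_rpow_of_nonneg _ _ h0.le,
      ENNReal.mul_rpow_eq_ite d μ]
    rw [if_neg (by simp [hμ, ht])]
    have : μ = μ ^ α * μ ^ (1 - α) := by
      rw [← ENNReal.rpow_add _ _ hμ ht]; simp
    conv_lhs => rw [this]
    ring

structure Part {X : Type*} (m0 : MeasurableSpace X) where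
  prt : Finset (Set X)
  h : ∀ A ∈ (prt : Set (Set X)), MeasurableSet A
  hd : (prt : Set (Set X)).PairwiseDisjoint id
  hu : ⋃₀ (prt : Set (Set X)) = Set.univ

abbrev Part.ms {X : Type*} {m0 : MeasurableSpace X} (ϖ : Part m0) : MeasurableSpace X :=
  MeasurableSpace.generateFrom (ϖ.prt : Set (Set X))

lemma Part.le {X : Type*} {m0 : MeasurableSpace X} (ϖ : Part m0) : ϖ.ms ≤ m0 :=
  MeasurableSpace.generateFrom_le ϖ.h

section parts
set_option linter.unusedSectionVars false
variable {X : Type*} {m0 : MeasurableSpace X} (P Q : Measure X)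

/-- Hellinger integral on a partition -/
noncomputable def hP (ϖ : Part m0) (α : ℝ) : ℝ≥0∞ :=
  @hellingerInt X ϖ.ms α (P.trim ϖ.le) (Q.trim ϖ.le)

noncomputable def rP (ϖ : Part m0) (α : ℝ) : EReal :=
  @renyiSimple X ϖ.ms α (P.trim ϖ.le) (Q.trim ϖ.le)

lemma rP_eq (ϖ : Part m0) (α : ℝ) :
    rP P Q ϖ α = (((α - 1)⁻¹ : ℝ) : EReal) * ENNReal.log (hP P Q ϖ α) := rfl

/-- density on a partition -/
noncomputable def dP (ϖ : Part m0) : X → ℝ≥0∞ :=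
  @Measure.rnDeriv X ϖ.ms (P.trim ϖ.le) (P.trim ϖ.le + Q.trim ϖ.le)
noncomputable def dQ (ϖ : Part m0) : X → ℝ≥0∞ :=
  @Measure.rnDeriv X ϖ.ms (Q.trim ϖ.le) (P.trim ϖ.le + Q.trim ϖ.le)

lemma dP_meas (ϖ : Part m0) : Measurable[ϖ.ms] (dP P Q ϖ) :=
  @Measure.measurable_rnDeriv X ϖ.ms _ _
lemma dQ_meas (ϖ : Part m0) : Measurable[ϖ.ms] (dQ P Q ϖ) :=
  @Measure.measurable_rnDeriv X ϖ.ms _ _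
lemma dP_meas' (ϖ : Part m0) : Measurable (dP P Q ϖ) := (dP_meas P Q ϖ).mono ϖ.le le_rfl
lemma dQ_meas' (ϖ : Part m0) : Measurable (dQ P Q ϖ) := (dQ_meas P Q ϖ).mono ϖ.le le_rfl

lemma hP_int (ϖ : Part m0) (α : ℝ) :
    hP P Q ϖ α = ∫⁻ x, dP P Q ϖ x ^ α * dQ P Q ϖ x ^ (1 - α) ∂(P + Q) := by
  have hm : Measurable[ϖ.ms] (fun x => dP P Q ϖ x ^ α * dQ P Q ϖ x ^ (1 - α)) := by
    have := dP_meas P Q ϖ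
    have := dQ_meas P Q ϖ
    fun_prop
  rw [← lintegral_trim ϖ.le hm, trim_add]
  rfl

variable [IsFiniteMeasure P] [IsFiniteMeasure Q]

lemma d_add (ϖ : Part m0) : ∀ᵐ x ∂(P + Q), dP P Q ϖ x + dQ P Q ϖ x = 1 := by
  have := add_one (P.trim ϖ.le) (Q.trim ϖ.le)
  rw [← trim_add] at this
  have := ae_of_ae_trim ϖ.le this
  rw [trim_add] at this
  exact this

lemma hP_sum (ϖ : Part m0) {α : ℝ} (h0 : 0 < α) :
    hP P Q ϖ α = ∑ A ∈ ϖ.prt, P A ^ α * Q A ^ (1 - α) := by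
  unfold hP
  rw [hell_sum (m0 := ϖ.ms) (P.trim ϖ.le) (Q.trim ϖ.le) α ϖ.prt
    (fun A hA => MeasurableSpace.measurableSet_generateFrom hA) ϖ.hd ϖ.hu]
  refine Finset.sum_congr rfl fun A hA => ?_
  rw [cell_eq ϖ.hd hA h0, trim_measurableSet_eq ϖ.le (MeasurableSpace.measurableSet_generateFrom hA),
    trim_measurableSet_eq ϖ.le (MeasurableSpace.measurableSet_generateFrom hA)]

lemma hP_lt (ϖ : Part m0) {α : ℝ} (h0 : 0 < α) (h1 : α < 1) :
    hellingerInt α P Q ≤ hP P Q ϖ α := by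
  rw [hP_sum P Q ϖ h0, hell_sum P Q α ϖ.prt ϖ.h ϖ.hd ϖ.hu]
  exact Finset.sum_le_sum fun A hA => cell_lt P Q h0 h1 (ϖ.h A hA)

lemma hP_gt (ϖ : Part m0) {α : ℝ} (h1 : 1 < α) :
    hP P Q ϖ α ≤ hellingerInt α P Q := by
  rw [hP_sum P Q ϖ (by linarith), hell_sum P Q α ϖ.prt ϖ.h ϖ.hd ϖ.hu]
  exact Finset.sum_le_sum fun A hA => cell_gt P Q h1 (ϖ.h A hA)

lemma rP_le (ϖ : Part m0) {α : ℝ} (h0 : 0 < α) (h1 : α ≠ 1) :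
    rP P Q ϖ α ≤ renyiSimple α P Q := by
  rw [rP_eq, renyiSimple]
  rcases lt_or_gt_of_ne h1 with h1 | h1
  · rw [mul_comm, mul_comm _ (ENNReal.log (hellingerInt α P Q))]
    refine EReal.mul_le_mul_of_nonpos_right (ENNReal.log_le_log (hP_lt P Q ϖ h0 h1)) ?_
    rw [EReal.coe_nonpos, inv_nonpos]; linarith
  · have hc : 0 ≤ (((α - 1)⁻¹ : ℝ) : EReal) := by
      rw [EReal.coe_nonneg, inv_nonneg]; linarith
    have := hP_gt P Q ϖ h1
    gcongr

lemma set_dP (ϖ : Part m0) {s : Set X} (hs : MeasurableSet[ϖ.ms] s) :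
    ∫⁻ x in s, dP P Q ϖ x ∂((P + Q).trim ϖ.le) = P s := by
  have := setP (P.trim ϖ.le) (Q.trim ϖ.le) hs
  rw [trim_measurableSet_eq ϖ.le hs] at this
  rw [trim_add]
  exact this

lemma set_trim (ϖ : Part m0) {s : Set X} (hs : MeasurableSet[ϖ.ms] s) {f : X → ℝ≥0∞}
    (hf : Measurable[ϖ.ms] f) :
    ∫⁻ x in s, f x ∂((P + Q).trim ϖ.le) = ∫⁻ x in s, f x ∂(P + Q) := by
  rw [restrict_trim ϖ.le _ hs, lintegral_trim ϖ.le hf]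

lemma le_dP (ϖ : Part m0) {g : X → ℝ≥0∞} (hg : Measurable[ϖ.ms] g)
    (h : ∀ᵐ x ∂(P + Q), g x ≤ P.rnDeriv (P + Q) x) : ∀ᵐ x ∂(P + Q), g x ≤ dP P Q ϖ x := by
  refine ae_of_ae_trim ϖ.le ?_
  refine ae_le_of_forall_setLIntegral_le_of_sigmaFinite hg fun s hs _ => ?_
  rw [set_dP P Q ϖ hs, set_trim P Q ϖ hs hg, ← setP P Q (ϖ.le s hs)]
  exact lintegral_mono_ae (ae_restrict_of_ae h)

lemma dP_le (ϖ : Part m0) {g : X → ℝ≥0∞} (hg : Measurable[ϖ.ms] g)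
    (h : ∀ᵐ x ∂(P + Q), P.rnDeriv (P + Q) x ≤ g x) : ∀ᵐ x ∂(P + Q), dP P Q ϖ x ≤ g x := by
  refine ae_of_ae_trim ϖ.le ?_
  refine ae_le_of_forall_setLIntegral_le_of_sigmaFinite (dP_meas P Q ϖ) fun s hs _ => ?_
  rw [set_dP P Q ϖ hs, set_trim P Q ϖ hs hg, ← setP P Q (ϖ.le s hs)]
  exact lintegral_mono_ae (ae_restrict_of_ae h)

/-- partition into level sets of a bounded natural-valued function -/
lemma exists_part (k : X → ℕ) (hk : Measurable k) (N : ℕ) (hN : ∀ x, k x ≤ N) :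
    ∃ ϖ : Part m0, Measurable[ϖ.ms] k := by
  refine ⟨⟨(Finset.range (N + 1)).image (fun i => k ⁻¹' {i}), ?_, ?_, ?_⟩, ?_⟩
  · intro A hA
    simp only [Finset.coe_image, Set.mem_image] at hA
    obtain ⟨i, _, rfl⟩ := hA
    exact hk (measurableSet_singleton i)
  · intro A hA B hB hAB
    simp only [Finset.coe_image, Set.mem_image] at hA hB
    obtain ⟨i, _, rfl⟩ := hA
    obtain ⟨j, _, rfl⟩ := hB
    have : i ≠ j := by rintro rfl; exact hAB rfl
    exact Disjoint.preimage k (by simpa using this)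
  · ext x
    simp only [Set.mem_univ, iff_true, Set.mem_sUnion]
    refine ⟨k ⁻¹' {k x}, ?_, rfl⟩
    simp only [Finset.coe_image, Set.mem_image]
    exact ⟨k x, by simpa [Nat.lt_succ_iff] using hN x, rfl⟩
  · refine @measurable_to_countable' ℕ X _ _ (_) k fun i => ?_
    by_cases hi : i ≤ N
    · apply MeasurableSpace.measurableSet_generateFrom
      simp only [Finset.coe_image, Set.mem_image]
      exact ⟨i, by simpa [Nat.lt_succ_iff] using hi, rfl⟩
    · have : k ⁻¹' {i} = ∅ := by
        ext x
        simp only [Set.mem_preimage, Set.mem_singleton_iff, Set.mem_empty_iff_false, iff_false]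
        rintro rfl; exact hi (hN x)
      rw [this]
      exact @MeasurableSet.empty X (_)

lemma approx (n : ℕ) : ∃ ϖ : Part m0, ∀ᵐ x ∂(P + Q),
    dP P Q ϖ x ≤ P.rnDeriv (P + Q) x + ((n : ℝ≥0∞) + 1)⁻¹ ∧
    P.rnDeriv (P + Q) x ≤ dP P Q ϖ x + ((n : ℝ≥0∞) + 1)⁻¹ := by
  set p := P.rnDeriv (P + Q) with hp
  have hpm : Measurable p := Measure.measurable_rnDeriv _ _
  let k : X → ℕ := fun x => min (n + 1) ⌊((n : ℝ) + 1) * (p x).toReal⌋₊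
  have hk : Measurable k := by
    have : Measurable fun x => ⌊((n : ℝ) + 1) * (p x).toReal⌋₊ := by fun_prop
    exact measurable_const.min this
  obtain ⟨ϖ, hϖ⟩ := exists_part k hk (n + 1) (fun x => min_le_left _ _)
  refine ⟨ϖ, ?_⟩
  let g : X → ℝ≥0∞ := fun x => (k x : ℝ≥0∞) * ((n : ℝ≥0∞) + 1)⁻¹
  have hg : Measurable[ϖ.ms] g :=
    (measurable_from_nat (f := fun i : ℕ => (i : ℝ≥0∞) * ((n : ℝ≥0∞) + 1)⁻¹)).comp hϖ
  have hgr : ∀ x, g x = ENNReal.ofReal ((k x : ℝ) / (n + 1)) := by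
    intro x
    rw [ENNReal.ofReal_div_of_pos (by positivity), ENNReal.ofReal_natCast,
      ENNReal.ofReal_add (by positivity) (by positivity), ENNReal.ofReal_natCast, ENNReal.ofReal_one,
      div_eq_mul_inv]
  have hgr2 : ((n : ℝ≥0∞) + 1)⁻¹ = ENNReal.ofReal (1 / (n + 1)) := by
    rw [ENNReal.ofReal_div_of_pos (by positivity),
      ENNReal.ofReal_add (by positivity) (by positivity), ENNReal.ofReal_natCast, ENNReal.ofReal_one,
      one_div]
  have hp1 : ∀ᵐ x ∂(P + Q), p x ≤ 1 := by
    filter_upwards [add_one P Q] with x hx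
    rw [← hx]; exact le_self_add
  have hkx : ∀ x, p x ≤ 1 → (k x : ℝ) ≤ (n + 1) * (p x).toReal ∧
      (n + 1) * (p x).toReal ≤ k x + 1 := by
    intro x hx
    have h1 : (p x).toReal ≤ 1 := by
      simpa using ENNReal.toReal_mono ENNReal.one_ne_top hx
    have h0 : 0 ≤ (p x).toReal := ENNReal.toReal_nonneg
    have hle : ((n : ℝ) + 1) * (p x).toReal ≤ n + 1 := by
      nlinarith [(Nat.cast_nonneg n : (0:ℝ) ≤ n)]
    have hfl : ⌊((n : ℝ) + 1) * (p x).toReal⌋₊ ≤ n + 1 := by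
      apply Nat.floor_le_of_le; push_cast; exact hle
    have : k x = ⌊((n : ℝ) + 1) * (p x).toReal⌋₊ := min_eq_right hfl
    rw [this]
    exact ⟨Nat.floor_le (by positivity), (Nat.lt_floor_add_one _).le⟩
  have h1 : ∀ᵐ x ∂(P + Q), g x ≤ p x := by
    filter_upwards [hp1] with x hx
    rw [hgr, ENNReal.ofReal_le_iff_le_toReal (ne_top_of_le_ne_top ENNReal.one_ne_top hx),
      div_le_iff₀' (by positivity)]
    exact (hkx x hx).1
  have h2 : ∀ᵐ x ∂(P + Q), p x ≤ g x + ((n : ℝ≥0∞) + 1)⁻¹ := by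
    filter_upwards [hp1] with x hx
    rw [hgr, hgr2, ← ENNReal.ofReal_add (by positivity) (by positivity), ← add_div]
    rw [ENNReal.le_ofReal_iff_toReal_le (ne_top_of_le_ne_top ENNReal.one_ne_top hx) (by positivity),
      le_div_iff₀' (by positivity)]
    exact (hkx x hx).2
  have hg2 : Measurable[ϖ.ms] fun x => g x + ((n : ℝ≥0∞) + 1)⁻¹ := by fun_prop
  filter_upwards [h1, h2, le_dP P Q ϖ hg h1, dP_le P Q ϖ hg2 h2] with x a1 a2 a3 a4
  exact ⟨a4.trans (by gcongr), a2.trans (by gcongr)⟩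

lemma exists_seq : ∃ ϖ : ℕ → Part m0, ∀ α : ℝ, 0 < α → α ≠ 1 →
    Tendsto (fun n => hP P Q (ϖ n) α) atTop (𝓝 (hellingerInt α P Q)) := by
  choose ϖ hϖ using approx P Q
  refine ⟨ϖ, fun α h0 h1 => ?_⟩
  have hlim : ∀ᵐ x ∂(P + Q), Tendsto (fun n => dP P Q (ϖ n) x ^ α * dQ P Q (ϖ n) x ^ (1 - α))
      atTop (𝓝 (P.rnDeriv (P + Q) x ^ α * Q.rnDeriv (P + Q) x ^ (1 - α))) := by
    filter_upwards [ae_all_iff.2 hϖ, ae_all_iff.2 (fun n => d_add P Q (ϖ n)), add_one P Q]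
      with x hx hx1 hx2
    set p := P.rnDeriv (P + Q) x
    set q := Q.rnDeriv (P + Q) x
    have hpt : p ≠ ∞ := by intro h; simp [h] at hx2
    have hqt : q ≠ ∞ := by intro h; simp [h] at hx2
    have hinv : Tendsto (fun n : ℕ => ((n : ℝ≥0∞) + 1)⁻¹) atTop (𝓝 0) := by
      have := (tendsto_add_atTop_iff_nat 1).2 ENNReal.tendsto_inv_nat_nhds_zero
      simpa using this
    have tp : Tendsto (fun n => dP P Q (ϖ n) x) atTop (𝓝 p) := by
      refine tendsto_of_tendsto_of_tendsto_of_le_of_le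
        (g := fun n : ℕ => p - ((n : ℝ≥0∞) + 1)⁻¹) (h := fun n : ℕ => p + ((n : ℝ≥0∞) + 1)⁻¹)
        ?_ ?_ (fun n => ?_) (fun n => (hx n).1)
      · simpa using ENNReal.Tendsto.sub (tendsto_const_nhds (x := p)) hinv (Or.inl hpt)
      · simpa using (tendsto_const_nhds (x := p)).add hinv
      · exact tsub_le_iff_right.2 (hx n).2
    have tq : Tendsto (fun n => dQ P Q (ϖ n) x) atTop (𝓝 q) := by
      have hq : q = 1 - p := by rw [← hx2]; exact (ENNReal.add_sub_cancel_left hpt).symm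
      have : ∀ n, dQ P Q (ϖ n) x = 1 - dP P Q (ϖ n) x := by
        intro n
        have hf : dP P Q (ϖ n) x ≠ ∞ := by intro h; have := hx1 n; simp [h] at this
        rw [← hx1 n]; exact (ENNReal.add_sub_cancel_left hf).symm
      simp_rw [this, hq]
      exact ENNReal.Tendsto.sub tendsto_const_nhds tp (Or.inl ENNReal.one_ne_top)
    refine ENNReal.Tendsto.mul (tp.ennrpow_const α) ?_ (tq.ennrpow_const (1 - α)) ?_
    · rcases eq_or_ne p 0 with hp | hp
      · right
        rw [hp, zero_add] at hx2
        rw [hx2]; simp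
      · left; simp [ENNReal.rpow_eq_zero_iff, hp, hpt]
    · right; exact ENNReal.rpow_ne_top_of_nonneg h0.le hpt
  have hmeas : ∀ n, Measurable fun x => dP P Q (ϖ n) x ^ α * dQ P Q (ϖ n) x ^ (1 - α) := by
    intro n
    have := dP_meas' P Q (ϖ n)
    have := dQ_meas' P Q (ϖ n)
    fun_prop
  rcases lt_or_gt_of_ne h1 with h1 | h1
  · simp_rw [hP_int]
    refine tendsto_lintegral_filter_of_dominated_convergence (fun _ => 1)
      (Eventually.of_forall hmeas) (Eventually.of_forall fun n => ?_) (by simp) hlim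
    filter_upwards [d_add P Q (ϖ n)] with x hx
    have a1 : dP P Q (ϖ n) x ≤ 1 := by rw [← hx]; exact le_self_add
    have a2 : dQ P Q (ϖ n) x ≤ 1 := by rw [← hx]; exact le_add_self
    exact mul_le_one' (ENNReal.rpow_le_one a1 h0.le) (ENNReal.rpow_le_one a2 (by linarith))
  · refine tendsto_of_le_liminf_of_limsup_le ?_ ?_
    · simp_rw [hP_int]
      refine le_trans (le_of_eq ?_) (lintegral_liminf_le hmeas)
      refine lintegral_congr_ae ?_
      filter_upwards [hlim] with x hx
      exact hx.liminf_eq.symm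
    · exact limsup_le_of_le (by isBoundedDefault)
        (Eventually.of_forall fun n => hP_gt P Q (ϖ n) h1)

lemma simple_le {α : ℝ} (h0 : 0 < α) (h1 : α ≠ 1) :
    renyiSimple α P Q ≤ ⨆ ϖ : Part m0, rP P Q ϖ α := by
  obtain ⟨ϖ, hϖ⟩ := exists_seq P Q
  have h := (ENNReal.continuous_log.tendsto _).comp (hϖ α h0 h1)
  have hne : (((α - 1)⁻¹ : ℝ) : EReal) ≠ 0 := by
    simpa [sub_eq_zero] using h1
  have h2 : Tendsto (fun n => rP P Q (ϖ n) α) atTop (𝓝 (renyiSimple α P Q)) :=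
    EReal.Tendsto.mul tendsto_const_nhds h (Or.inl hne) (Or.inl hne)
      (Or.inl (EReal.coe_ne_bot _)) (Or.inl (EReal.coe_ne_top _))
  exact le_of_tendsto' h2 fun n => le_iSup (fun ϖ : Part m0 => rP P Q ϖ α) (ϖ n)

end parts

lemma rpow_tend {x : ℝ≥0∞} (hx : x ≠ ∞) {y : ℝ} (h : x ≠ 0 ∨ 0 < y) :
    Tendsto (fun a : ℝ => x ^ a) (𝓝 y) (𝓝 (x ^ y)) := by
  lift x to ℝ≥0 using hx
  rcases eq_or_ne x 0 with rfl | hx0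
  · have hy : 0 < y := by simpa using h
    simp only [ENNReal.coe_zero]
    rw [ENNReal.zero_rpow_of_pos hy]
    refine tendsto_const_nhds.congr' ?_
    filter_upwards [lt_mem_nhds hy] with a ha
    rw [ENNReal.zero_rpow_of_pos ha]
  · simp_rw [← ENNReal.coe_rpow_of_ne_zero hx0]
    rw [ENNReal.tendsto_coe]
    exact Tendsto.nnrpow tendsto_const_nhds tendsto_id (Or.inl hx0)

section final
set_option linter.unusedSectionVars false
variable {X : Type*} {m0 : MeasurableSpace X} (P Q : Measure X)
  [IsProbabilityMeasure P] [IsProbabilityMeasure Q]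

/-- the support of the density of the first measure -/
def supp : Set X := {x | P.rnDeriv (P + Q) x ≠ 0}

lemma supp_meas : MeasurableSet (supp P Q) :=
  (Measure.measurable_rnDeriv P (P + Q) (measurableSet_singleton 0)).compl

lemma supp_compl : P (supp P Q)ᶜ = 0 := by
  rw [← setP P Q (supp_meas P Q).compl]
  rw [setLIntegral_congr_fun (supp_meas P Q).compl (g := fun _ => 0)]
  · simp
  · intro x hx
    simpa [supp] using hx

lemma supp_one : P (supp P Q) = 1 := by
  rw [← prob_compl_eq_zero_iff (supp_meas P Q)]; exact supp_compl P Q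

lemma hell_zero : Tendsto (fun a : ℝ => hellingerInt a P Q) (𝓝[>] 0) (𝓝 (Q (supp P Q))) := by
  have e : Q (supp P Q) = ∫⁻ x, (supp P Q).indicator (Q.rnDeriv (P + Q)) x ∂(P + Q) := by
    rw [lintegral_indicator (supp_meas P Q), setQ P Q (supp_meas P Q)]
  rw [e]
  have hI : ∀ᶠ a : ℝ in 𝓝[>] 0, a ∈ Set.Ioo (0:ℝ) 1 := Ioo_mem_nhdsGT one_pos
  refine tendsto_lintegral_filter_of_dominated_convergence (fun _ => 1)
      (Eventually.of_forall fun a => by fun_prop) ?_ (by simp) ?_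
  · filter_upwards [hI] with a ha
    filter_upwards [add_one P Q] with x hx
    have a1 : P.rnDeriv (P + Q) x ≤ 1 := by rw [← hx]; exact le_self_add
    have a2 : Q.rnDeriv (P + Q) x ≤ 1 := by rw [← hx]; exact le_add_self
    exact mul_le_one' (ENNReal.rpow_le_one a1 ha.1.le)
      (ENNReal.rpow_le_one a2 (by linarith [ha.2]))
  · filter_upwards [add_one P Q] with x hx
    have hpt : P.rnDeriv (P + Q) x ≠ ∞ := by intro h; simp [h] at hx
    have hqt : Q.rnDeriv (P + Q) x ≠ ∞ := by intro h; simp [h] at hx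
    by_cases hxs : x ∈ supp P Q
    · rw [Set.indicator_of_mem hxs]
      have hp0 : P.rnDeriv (P + Q) x ≠ 0 := hxs
      have t1 := rpow_tend hpt (y := 0) (Or.inl hp0)
      have t2 := rpow_tend hqt (y := 1) (Or.inr one_pos)
      have t3 : Tendsto (fun a : ℝ => 1 - a) (𝓝 0) (𝓝 1) := by
        have : Continuous fun a : ℝ => 1 - a := by fun_prop
        simpa using this.tendsto 0
      have t4 := t2.comp t3
      rw [ENNReal.rpow_one] at t4
      rw [ENNReal.rpow_zero] at t1
      have := ENNReal.Tendsto.mul t1 (Or.inl one_ne_zero) t4 (Or.inr ENNReal.one_ne_top)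
      rw [one_mul] at this
      exact this.mono_left nhdsWithin_le_nhds
    · rw [Set.indicator_of_notMem hxs]
      have hp0 : P.rnDeriv (P + Q) x = 0 := by simpa [supp] using hxs
      refine tendsto_const_nhds.congr' ?_
      filter_upwards [hI] with a ha
      rw [hp0, ENNReal.zero_rpow_of_pos ha.1, zero_mul]

lemma renyi_zero : Tendsto (fun a : ℝ => renyiSimple a P Q) (𝓝[>] 0)
    (𝓝 (((-1 : ℝ) : EReal) * ENNReal.log (Q (supp P Q)))) := by
  have h := (ENNReal.continuous_log.tendsto _).comp (hell_zero P Q)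
  have hc : Tendsto (fun a : ℝ => (((a - 1)⁻¹ : ℝ) : EReal)) (𝓝[>] 0) (𝓝 ((-1 : ℝ) : EReal)) := by
    rw [EReal.tendsto_coe]
    have : ContinuousAt (fun a : ℝ => (a - 1)⁻¹) 0 := by
      apply ContinuousAt.inv₀ (by fun_prop) (by norm_num)
    have t := this.tendsto.mono_left (nhdsWithin_le_nhds (s := Set.Ioi 0))
    convert t using 2
    norm_num
  have hne : ((-1 : ℝ) : EReal) ≠ 0 := by simp
  exact EReal.Tendsto.mul hc h (Or.inl hne) (Or.inl hne)
      (Or.inl (EReal.coe_ne_bot _)) (Or.inl (EReal.coe_ne_top _))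

lemma supp_part : ∃ ϖ : Part m0, ∀ a ∈ Set.Ioo (0:ℝ) 1,
    rP P Q ϖ a = ((-1 : ℝ) : EReal) * ENNReal.log (Q (supp P Q)) := by
  have hne : Nonempty X := by
    by_contra h
    have := not_nonempty_iff.1 h
    have h1 := measure_univ (μ := P)
    rw [Set.univ_eq_empty_iff.2 this] at h1
    simp at h1
  have hA : supp P Q ≠ (supp P Q)ᶜ := by
    intro h
    have h1 := supp_one P Q
    rw [h, supp_compl] at h1
    simp at h1
  refine ⟨⟨{supp P Q, (supp P Q)ᶜ}, ?_, ?_, ?_⟩, ?_⟩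
  · intro A hA
    simp only [Finset.coe_insert, Finset.coe_singleton, Set.mem_insert_iff,
      Set.mem_singleton_iff] at hA
    rcases hA with rfl | rfl
    · exact supp_meas P Q
    · exact (supp_meas P Q).compl
  · rw [Finset.coe_insert, Finset.coe_singleton]
    exact Set.pairwise_pair.2 fun _ => ⟨disjoint_compl_right, disjoint_compl_left⟩
  · simp
  · intro a ha
    rw [rP_eq, hP_sum P Q _ ha.1]
    simp only
    rw [Finset.sum_pair hA, supp_one, supp_compl, ENNReal.one_rpow, ENNReal.zero_rpow_of_pos ha.1,
      zero_mul, one_mul, add_zero, ENNReal.log_rpow, ← mul_assoc, ← EReal.coe_mul]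
    congr 2
    have : a - 1 ≠ 0 := by linarith [ha.2]
    field_simp
    ring

noncomputable def rD (ϖ : Part m0) (α : ℝ≥0∞) : EReal :=
  @renyiDiv X ϖ.ms α (P.trim ϖ.le) (Q.trim ϖ.le)

lemma rD_zero (ϖ : Part m0) : rD P Q ϖ 0 = limsup (fun a : ℝ => rP P Q ϖ a) (𝓝[>] 0) := by
  unfold rD renyiDiv
  rw [if_pos rfl]; rfl

lemma rD_one (ϖ : Part m0) : rD P Q ϖ 1 = limsup (fun a : ℝ => rP P Q ϖ a) (𝓝[<] 1) := by
  unfold rD renyiDiv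
  rw [if_neg one_ne_zero, if_pos rfl]; rfl

lemma rD_top (ϖ : Part m0) : rD P Q ϖ ∞ = limsup (fun a : ℝ => rP P Q ϖ a) atTop := by
  unfold rD renyiDiv
  rw [if_neg ENNReal.top_ne_zero, if_neg ENNReal.top_ne_one, if_pos rfl]; rfl

lemma rD_simple (ϖ : Part m0) {α : ℝ≥0∞} (h0 : α ≠ 0) (h1 : α ≠ 1) (ht : α ≠ ∞) :
    rD P Q ϖ α = rP P Q ϖ α.toReal := by
  unfold rD renyiDiv
  rw [if_neg h0, if_neg h1, if_neg ht]; rfl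

lemma rP_mono_lt (ϖ : Part m0) {a b : ℝ} (ha : 0 < a) (hab : a < b) (hb : b < 1) :
    rP P Q ϖ a ≤ rP P Q ϖ b := by
  have : IsProbabilityMeasure (P.trim ϖ.le) := ⟨by
    rw [trim_measurableSet_eq ϖ.le (@MeasurableSet.univ X ϖ.ms)]; exact measure_univ⟩
  exact renyi_mono_lt (P.trim ϖ.le) (Q.trim ϖ.le) ha hab hb

lemma rP_mono_gt (ϖ : Part m0) {a b : ℝ} (ha : 1 < a) (hab : a < b) :
    rP P Q ϖ a ≤ rP P Q ϖ b := by
  have : IsProbabilityMeasure (P.trim ϖ.le) := ⟨by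
    rw [trim_measurableSet_eq ϖ.le (@MeasurableSet.univ X ϖ.ms)]; exact measure_univ⟩
  exact renyi_mono_gt (P.trim ϖ.le) (Q.trim ϖ.le) ha hab

lemma toReal_ne_one {α : ℝ≥0∞} (h1 : α ≠ 1) : α.toReal ≠ 1 := by
  intro h
  exact h1 ((ENNReal.toReal_eq_one_iff α).1 h)

lemma upper (α : ℝ≥0∞) : renyiDiv α P Q ≤ ⨆ ϖ : Part m0, rD P Q ϖ α := by
  by_cases h0 : α = 0
  · subst h0
    obtain ⟨ϖ, hϖ⟩ := supp_part P Q
    refine le_trans ?_ (le_iSup _ ϖ)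
    rw [rD_zero, renyiDiv, if_pos rfl, (renyi_zero P Q).limsup_eq]
    have : Tendsto (fun a : ℝ => rP P Q ϖ a) (𝓝[>] 0)
        (𝓝 (((-1 : ℝ) : EReal) * ENNReal.log (Q (supp P Q)))) := by
      refine tendsto_const_nhds.congr' ?_
      filter_upwards [Ioo_mem_nhdsGT one_pos] with a ha
      exact (hϖ a ha).symm
    rw [this.limsup_eq]
  by_cases h1 : α = 1
  · subst h1
    rw [renyiDiv, if_neg one_ne_zero, if_pos rfl]
    refine limsup_le_of_le (by isBoundedDefault) ?_
    filter_upwards [Ioo_mem_nhdsLT one_pos] with a ha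
    refine (simple_le P Q ha.1 ha.2.ne).trans (iSup_mono fun ϖ => ?_)
    rw [rD_one]
    refine le_limsup_of_frequently_le (Eventually.frequently ?_) (by isBoundedDefault)
    filter_upwards [Ioo_mem_nhdsLT ha.2] with b hb
    exact rP_mono_lt P Q ϖ ha.1 hb.1 hb.2
  by_cases ht : α = ∞
  · subst ht
    rw [renyiDiv, if_neg ENNReal.top_ne_zero, if_neg ENNReal.top_ne_one, if_pos rfl]
    refine limsup_le_of_le (by isBoundedDefault) ?_
    filter_upwards [eventually_gt_atTop 1] with a ha
    refine (simple_le P Q (by linarith) ha.ne').trans (iSup_mono fun ϖ => ?_)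
    rw [rD_top]
    refine le_limsup_of_frequently_le (Eventually.frequently ?_) (by isBoundedDefault)
    filter_upwards [eventually_gt_atTop a] with b hb
    exact rP_mono_gt P Q ϖ ha hb
  · rw [renyiDiv, if_neg h0, if_neg h1, if_neg ht]
    simp_rw [rD_simple P Q _ h0 h1 ht]
    exact simple_le P Q (ENNReal.toReal_pos h0 ht) (toReal_ne_one h1)

lemma lower (ϖ : Part m0) (α : ℝ≥0∞) : rD P Q ϖ α ≤ renyiDiv α P Q := by
  by_cases h0 : α = 0
  · subst h0
    rw [rD_zero, renyiDiv, if_pos rfl]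
    refine limsup_le_limsup ?_
    filter_upwards [Ioo_mem_nhdsGT one_pos] with a ha
    exact rP_le P Q ϖ ha.1 ha.2.ne
  by_cases h1 : α = 1
  · subst h1
    rw [rD_one, renyiDiv, if_neg one_ne_zero, if_pos rfl]
    refine limsup_le_limsup ?_
    filter_upwards [Ioo_mem_nhdsLT one_pos] with a ha
    exact rP_le P Q ϖ ha.1 ha.2.ne
  by_cases ht : α = ∞
  · subst ht
    rw [rD_top, renyiDiv, if_neg ENNReal.top_ne_zero, if_neg ENNReal.top_ne_one, if_pos rfl]
    refine limsup_le_limsup ?_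
    filter_upwards [eventually_gt_atTop 1] with a ha
    exact rP_le P Q ϖ (by linarith) ha.ne'
  · rw [rD_simple P Q _ h0 h1 ht, renyiDiv, if_neg h0, if_neg h1, if_neg ht]
    exact rP_le P Q ϖ (ENNReal.toReal_pos h0 ht) (toReal_ne_one h1)

end final
end RenyiAux

/-- **Rényi divergence as a supremum over finite partitions.** For every order
`α ∈ [0,∞]`, `D_α(P‖Q)` is the supremum, over all finite measurable partitions `prt`
of `X`, of the Rényi divergence of the restrictions of `P` and `Q` to the σ-algebra
generated by `prt`. -/
theorem renyiDiv_eq_iSup_finite_partitions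
    {X : Type*} {mX : MeasurableSpace X} (P Q : Measure X)
    [IsProbabilityMeasure P] [IsProbabilityMeasure Q] (α : ℝ≥0∞) :
    @renyiDiv X mX α P Q =
      ⨆ (prt : Finset (Set X)) (h : ∀ A ∈ (prt : Set (Set X)), MeasurableSet A)
        (_ : (prt : Set (Set X)).PairwiseDisjoint id)
        (_ : ⋃₀ (prt : Set (Set X)) = Set.univ),
        @renyiDiv X (MeasurableSpace.generateFrom (prt : Set (Set X))) α
          (@Measure.trim X (MeasurableSpace.generateFrom (prt : Set (Set X))) mX P
            (MeasurableSpace.generateFrom_le h))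
          (@Measure.trim X (MeasurableSpace.generateFrom (prt : Set (Set X))) mX Q
            (MeasurableSpace.generateFrom_le h)) := by
  refine le_antisymm ?_ ?_
  · refine (RenyiAux.upper P Q α).trans (iSup_le fun ϖ => ?_)
    exact le_iSup_of_le ϖ.prt (le_iSup_of_le ϖ.h (le_iSup_of_le ϖ.hd
      (le_iSup_of_le ϖ.hu le_rfl)))
  · refine iSup_le fun prt => iSup_le fun h => iSup_le fun hd => iSup_le fun hu => ?_
    exact RenyiAux.lower P Q ⟨prt, h, hd, hu⟩ α
end

section
/- For any simple order α ∈ (0,1) ∪ (1,∞) and any probability measures P, Q on a measurable space (X, 𝓐), (1−α)·D_α(P‖Q) = inf_R { α·D(R‖P) + (1−α)·D(R‖Q) }, where the infimum is over all probability distributions R on (X, 𝓐) and one adopts the convention that α·D(R‖P) + (1−α)·D(R‖Q) = ∞ whenever it would otherwise be undefined. Moreover, if the distribution P_α with μ-density p_α = p^α q^{1−α} / ∫ p^α q^{1−α} dμ is well defined (i.e. 0 < ∫ p^α q^{1−α} dμ < ∞) and either α ∈ (0,1) or D(P_α‖P) < ∞, then the infimum is uniquely achieved by R = P_α. -/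
open MeasureTheory Real Filter Set
open scoped ENNReal NNReal Topology Classical

/-- The objective `α D(R‖P) + (1-α) D(R‖Q)`, with the convention that it equals `∞`
whenever the sum would otherwise be undefined (which happens, for `α > 1`, exactly
when both Kullback-Leibler divergences are infinite). -/
noncomputable def klMix {X : Type*} [MeasurableSpace X]
    (α : ℝ) (R P Q : Measure X) : EReal :=
  if klDiv R P = ⊤ ∧ klDiv R Q = ⊤ then ⊤
  else ((α : ℝ) : EReal) * klDiv R P + ((1 - α : ℝ) : EReal) * klDiv R Q

/-- The tilted distribution `P_α` with `μ`-density `p^α q^(1-α) / ∫ p^α q^(1-α) dμ`. -/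
noncomputable def renyiTilt {X : Type*} [MeasurableSpace X]
    (α : ℝ) (μ : Measure X) (p q : X → ℝ≥0∞) : Measure X :=
  μ.withDensity fun x => p x ^ α * q x ^ (1 - α) / ∫⁻ y, p y ^ α * q y ^ (1 - α) ∂μ


lemma aux_fin {X : Type*} [MeasurableSpace X] {μ R P : Measure X} {p : X → ℝ≥0∞}
    [IsProbabilityMeasure P] (hp : Measurable p) (hP : P = μ.withDensity p) (hRP : R ≪ P) :
    ∀ᵐ x ∂ R, p x ≠ 0 ∧ p x ≠ ⊤ := by
  have h1 : ∫⁻ x, p x ∂μ = 1 := by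
    have := measure_univ (μ := P)
    rwa [hP, withDensity_apply _ MeasurableSet.univ, Measure.restrict_univ] at this
  have h2 : ∀ᵐ x ∂μ, p x < ⊤ := ae_lt_top hp (by simp [h1])
  apply hRP.ae_le
  change ∀ᵐ x ∂P, p x ≠ 0 ∧ p x ≠ ⊤
  rw [hP, ae_withDensity_iff hp]
  filter_upwards [h2] with x hx h0 using ⟨h0, hx.ne⟩

lemma aux_ac {X : Type*} [MeasurableSpace X] {μ R P : Measure X} {p : X → ℝ≥0∞}
    (hP : P = μ.withDensity p) (hRP : R ≪ P) : R ≪ μ :=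
  hRP.trans (hP ▸ withDensity_absolutelyContinuous _ _)

lemma aux_llr {X : Type*} [MeasurableSpace X] {μ R P : Measure X} [SigmaFinite μ] {p : X → ℝ≥0∞}
    [IsProbabilityMeasure P] [IsProbabilityMeasure R]
    (hp : Measurable p) (hP : P = μ.withDensity p) (hRP : R ≪ P) :
    llr R P =ᵐ[R] fun x => Real.log (R.rnDeriv μ x).toReal - Real.log (p x).toReal := by
  have hRμ := aux_ac hP hRP
  have h1 : R.rnDeriv P * P.rnDeriv μ =ᵐ[R] R.rnDeriv μ :=
    hRμ.ae_le (Measure.rnDeriv_mul_rnDeriv hRP)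
  have h2 : P.rnDeriv μ =ᵐ[R] p := by
    apply hRμ.ae_le
    rw [hP]
    exact Measure.rnDeriv_withDensity μ hp
  have h3 := Measure.rnDeriv_pos hRP
  have h4 := hRP.ae_le (Measure.rnDeriv_lt_top R P)
  filter_upwards [h1, h2, h3, h4, aux_fin hp hP hRP] with x h1 h2 h3 h4 h5
  rw [← h1, Pi.mul_apply, h2, ENNReal.toReal_mul, Real.log_mul, llr]
  · ring
  · exact (ENNReal.toReal_pos h3.ne' h4.ne).ne'
  · exact (ENNReal.toReal_pos h5.1 h5.2).ne'

lemma aux_hell {X : Type*} [MeasurableSpace X] (α : ℝ) (hα0 : 0 < α)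
    (P Q : Measure X) [IsProbabilityMeasure P] [IsProbabilityMeasure Q]
    (μ : Measure X) [SigmaFinite μ] (p q : X → ℝ≥0∞)
    (hp : Measurable p) (hq : Measurable q)
    (hP : P = μ.withDensity p) (hQ : Q = μ.withDensity q) :
    hellingerInt α P Q = ∫⁻ y, p y ^ α * q y ^ (1 - α) ∂μ := by
  have hS : P + Q = μ.withDensity (p + q) := by
    rw [withDensity_add_left hp, hP, hQ]
  have hSd : (P + Q).rnDeriv μ =ᵐ[μ] p + q := by
    rw [hS]; exact Measure.rnDeriv_withDensity μ (hp.add hq)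
  have hPd : P.rnDeriv μ =ᵐ[μ] p := by rw [hP]; exact Measure.rnDeriv_withDensity μ hp
  have hQd : Q.rnDeriv μ =ᵐ[μ] q := by rw [hQ]; exact Measure.rnDeriv_withDensity μ hq
  have hPS : P ≪ P + Q := Measure.AbsolutelyContinuous.rfl.add_right _
  have hQS : Q ≪ P + Q := by
    rw [add_comm]; exact Measure.AbsolutelyContinuous.rfl.add_right _
  have h1 : P.rnDeriv (P + Q) * (P + Q).rnDeriv μ =ᵐ[μ] P.rnDeriv μ :=
    Measure.rnDeriv_mul_rnDeriv hPS
  have h2 : Q.rnDeriv (P + Q) * (P + Q).rnDeriv μ =ᵐ[μ] Q.rnDeriv μ :=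
    Measure.rnDeriv_mul_rnDeriv hQS
  have hPf := Measure.rnDeriv_lt_top P μ
  have hQf := Measure.rnDeriv_lt_top Q μ
  unfold hellingerInt
  have hm : Measurable fun x => P.rnDeriv (P + Q) x ^ α * Q.rnDeriv (P + Q) x ^ (1 - α) := by
    fun_prop
  set f := P.rnDeriv (P + Q)
  set g := Q.rnDeriv (P + Q)
  rw [hS, lintegral_withDensity_eq_lintegral_mul _ (hp.add hq) hm]
  apply lintegral_congr_ae
  filter_upwards [h1, h2, hPf, hQf, hSd, hPd, hQd] with x h1 h2 h3 h4 h5 h6 h7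
  simp only [Pi.mul_apply, Pi.add_apply] at *
  rw [h5, h6] at h1
  rw [h5, h7] at h2
  rw [h6] at h3
  rw [h7] at h4
  have hst : p x + q x ≠ ⊤ := by simp [h3.ne, h4.ne]
  by_cases hs : p x + q x = 0
  · have : p x = 0 := by simpa using (add_eq_zero.1 hs).1
    rw [hs, this, ENNReal.zero_rpow_of_pos hα0]; simp
  have hf : f x ≠ ⊤ := by
    intro h; rw [h, ENNReal.top_mul hs] at h1; exact h3.ne h1.symm
  have hg : g x ≠ ⊤ := by
    intro h; rw [h, ENNReal.top_mul hs] at h2; exact h4.ne h2.symm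
  set s := p x + q x
  rw [← h1, ← h2, ENNReal.mul_rpow_of_ne_top hf hst, ENNReal.mul_rpow_of_ne_top hg hst]
  have : s = s ^ α * s ^ (1 - α) := by
    rw [← ENNReal.rpow_add _ _ hs hst]; simp
  nth_rewrite 1 [this]
  ring

lemma aux_lower {X : Type*} [MeasurableSpace X] {R T : Measure X}
    [IsProbabilityMeasure T] [IsProbabilityMeasure R] (h : R ≪ T) :
    ∃ g : X → ℝ, Integrable g R ∧ ∀ᵐ x ∂ R, - g x ≤ llr R T x := by
  refine ⟨fun x => (T.rnDeriv R x).toReal, Measure.integrable_toReal_rnDeriv, ?_⟩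
  filter_upwards [neg_llr h] with x hx
  have h1 : llr T R x ≤ (T.rnDeriv R x).toReal := Real.log_le_self ENNReal.toReal_nonneg
  simp only [Pi.neg_apply] at hx
  linarith

lemma aux_sandwich {X : Type*} [MeasurableSpace X] {R : Measure X} {f g h : X → ℝ}
    (hf : Measurable f) (hg : Integrable g R) (hh : Integrable h R)
    (h1 : ∀ᵐ x ∂ R, - g x ≤ f x) (h2 : ∀ᵐ x ∂ R, f x ≤ h x) : Integrable f R := by
  refine (hg.abs.add hh.abs).mono' hf.aestronglyMeasurable ?_
  filter_upwards [h1, h2] with x h1 h2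
  rw [Real.norm_eq_abs, abs_le]
  have := le_abs_self (g x)
  have := le_abs_self (h x)
  have := abs_nonneg (g x)
  have := abs_nonneg (h x)
  constructor <;> simp only [Pi.add_apply] <;> linarith

lemma aux_nonneg {X : Type*} [MeasurableSpace X] {R T : Measure X}
    [IsProbabilityMeasure T] [IsProbabilityMeasure R] (h : R ≪ T) (hi : Integrable (llr R T) R) :
    0 ≤ ∫ x, llr R T x ∂ R ∧ (∫ x, llr R T x ∂ R = 0 → R = T) := by
  rw [← InformationTheory.toReal_klDiv_of_measure_eq h (by simp)]
  refine ⟨ENNReal.toReal_nonneg, fun h0 => ?_⟩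
  rw [ENNReal.toReal_eq_zero_iff] at h0
  rcases h0 with h0 | h0
  · exact InformationTheory.klDiv_eq_zero_iff.1 h0
  · exact absurd h0 (InformationTheory.klDiv_ne_top h hi)

lemma aux_prob {X : Type*} [MeasurableSpace X] (α : ℝ)
    (μ : Measure X) (p q : X → ℝ≥0∞) (hp : Measurable p) (hq : Measurable q)
    (h0 : ∫⁻ y, p y ^ α * q y ^ (1 - α) ∂μ ≠ 0)
    (h1 : ∫⁻ y, p y ^ α * q y ^ (1 - α) ∂μ ≠ ⊤) :
    IsProbabilityMeasure (renyiTilt α μ p q) := by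
  constructor
  unfold renyiTilt
  rw [withDensity_apply _ MeasurableSet.univ, Measure.restrict_univ]
  simp only [div_eq_mul_inv]
  rw [lintegral_mul_const _ (by fun_prop), ENNReal.mul_inv_cancel h0 h1]

lemma aux_pos {X : Type*} [MeasurableSpace X] (α : ℝ)
    {P Q R : Measure X} [IsProbabilityMeasure P] [IsProbabilityMeasure Q] [IsProbabilityMeasure R]
    (μ : Measure X) (p q : X → ℝ≥0∞) (hp : Measurable p) (hq : Measurable q)
    (hP : P = μ.withDensity p) (hQ : Q = μ.withDensity q) (hRP : R ≪ P) (hRQ : R ≪ Q) :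
    ∫⁻ y, p y ^ α * q y ^ (1 - α) ∂μ ≠ 0 := by
  intro h
  rw [lintegral_eq_zero_iff (by fun_prop)] at h
  have h' := (aux_ac hP hRP).ae_le h
  have : ∀ᵐ x ∂ R, False := by
    filter_upwards [h', aux_fin hp hP hRP, aux_fin hq hQ hRQ] with x h1 h2 h3
    simp only [Pi.zero_apply, mul_eq_zero] at h1
    rcases h1 with h1 | h1
    · exact (ENNReal.rpow_pos (pos_iff_ne_zero.2 h2.1) h2.2).ne' h1
    · exact (ENNReal.rpow_pos (pos_iff_ne_zero.2 h3.1) h3.2).ne' h1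
  simp at this
  exact IsProbabilityMeasure.ne_zero R this

lemma aux_RT {X : Type*} [MeasurableSpace X] (α : ℝ)
    {P Q R : Measure X} [IsProbabilityMeasure P] [IsProbabilityMeasure Q] [IsProbabilityMeasure R]
    (μ : Measure X) [SigmaFinite μ] (p q : X → ℝ≥0∞) (hp : Measurable p) (hq : Measurable q)
    (hP : P = μ.withDensity p) (hQ : Q = μ.withDensity q) (hRP : R ≪ P) (hRQ : R ≪ Q)
    (h0 : ∫⁻ y, p y ^ α * q y ^ (1 - α) ∂μ ≠ 0)
    (h1 : ∫⁻ y, p y ^ α * q y ^ (1 - α) ∂μ ≠ ⊤) :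
    R ≪ renyiTilt α μ p q ∧
    ∀ᵐ x ∂ R, llr R (renyiTilt α μ p q) x = α * llr R P x + (1 - α) * llr R Q x
      + Real.log (∫⁻ y, p y ^ α * q y ^ (1 - α) ∂μ).toReal := by
  have hprob := aux_prob α μ p q hp hq h0 h1
  have hRμ := aux_ac hP hRP
  have hfp := aux_fin hp hP hRP
  have hfq := aux_fin hq hQ hRQ
  set H := ∫⁻ y, p y ^ α * q y ^ (1 - α) ∂μ with hH
  set T := renyiTilt α μ p q with hT
  have hT' : T = μ.withDensity fun x => p x ^ α * q x ^ (1 - α) / H := rfl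
  have hm : Measurable fun x => p x ^ α * q x ^ (1 - α) / H := by fun_prop
  have hRT : R ≪ T := by
    refine Measure.AbsolutelyContinuous.mk fun s hs h => ?_
    have h2 : ∀ᵐ x ∂T, x ∉ s := measure_eq_zero_iff_ae_notMem.1 h
    rw [hT', ae_withDensity_iff hm] at h2
    have h3 := hRμ.ae_le h2
    rw [measure_eq_zero_iff_ae_notMem]
    filter_upwards [h3, hfp, hfq] with x h3 h4 h5
    refine h3 (ENNReal.div_pos ?_ h1).ne'
    exact mul_ne_zero (ENNReal.rpow_pos (pos_iff_ne_zero.2 h4.1) h4.2).ne'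
      (ENNReal.rpow_pos (pos_iff_ne_zero.2 h5.1) h5.2).ne'
  refine ⟨hRT, ?_⟩
  filter_upwards [aux_llr hm hT' hRT, aux_llr hp hP hRP, aux_llr hq hQ hRQ, hfp, hfq]
    with x e1 e2 e3 h4 h5
  have a4 := ENNReal.toReal_pos h4.1 h4.2
  have a5 := ENNReal.toReal_pos h5.1 h5.2
  have aH := ENNReal.toReal_pos h0 h1
  rw [e1, e2, e3, ENNReal.toReal_div, ENNReal.toReal_mul, ← ENNReal.toReal_rpow,
    ← ENNReal.toReal_rpow, Real.log_div (by positivity) (by positivity),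
    Real.log_mul (by positivity) (by positivity), Real.log_rpow a4, Real.log_rpow a5]
  ring

lemma aux_klMix_fin {X : Type*} [MeasurableSpace X] (α : ℝ)
    {P Q R : Measure X} (hRP : R ≪ P) (hRQ : R ≪ Q)
    (hiP : Integrable (llr R P) R) (hiQ : Integrable (llr R Q) R) :
    klMix α R P Q = ((∫ x, (α * llr R P x + (1 - α) * llr R Q x) ∂ R : ℝ) : EReal) := by
  have e1 : klDiv R P = ((∫ x, llr R P x ∂ R : ℝ) : EReal) := if_pos ⟨hRP, hiP⟩
  have e2 : klDiv R Q = ((∫ x, llr R Q x ∂ R : ℝ) : EReal) := if_pos ⟨hRQ, hiQ⟩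
  unfold klMix
  rw [e1, e2, if_neg (by simp), integral_add (hiP.const_mul _) (hiQ.const_mul _), integral_const_mul, integral_const_mul]
  push_cast
  rfl

lemma aux_key {X : Type*} [MeasurableSpace X] (α : ℝ)
    {P Q R : Measure X} [IsProbabilityMeasure P] [IsProbabilityMeasure Q] [IsProbabilityMeasure R]
    (μ : Measure X) [SigmaFinite μ] (p q : X → ℝ≥0∞) (hp : Measurable p) (hq : Measurable q)
    (hP : P = μ.withDensity p) (hQ : Q = μ.withDensity q) (hRP : R ≪ P) (hRQ : R ≪ Q)
    (hiP : Integrable (llr R P) R) (hiQ : Integrable (llr R Q) R)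
    (h1 : ∫⁻ y, p y ^ α * q y ^ (1 - α) ∂μ ≠ ⊤) :
    - ENNReal.log (∫⁻ y, p y ^ α * q y ^ (1 - α) ∂μ) ≤ klMix α R P Q ∧
    (klMix α R P Q = - ENNReal.log (∫⁻ y, p y ^ α * q y ^ (1 - α) ∂μ) ↔
      R = renyiTilt α μ p q) := by
  have h0 := aux_pos α μ p q hp hq hP hQ hRP hRQ
  have hprob := aux_prob α μ p q hp hq h0 h1
  obtain ⟨hRT, hl⟩ := aux_RT α μ p q hp hq hP hQ hRP hRQ h0 h1
  rw [aux_klMix_fin α hRP hRQ hiP hiQ, ENNReal.log_pos_real h0 h1]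
  have hI : Integrable (fun x => α * llr R P x + (1 - α) * llr R Q x) R :=
    (hiP.const_mul _).add (hiQ.const_mul _)
  set H := ∫⁻ y, p y ^ α * q y ^ (1 - α) ∂μ with hH
  have hiT : Integrable (llr R (renyiTilt α μ p q)) R :=
    (hI.add (integrable_const (Real.log H.toReal))).congr (by
      filter_upwards [hl] with x hx using hx.symm)
  have e : ∫ x, llr R (renyiTilt α μ p q) x ∂ R =
      ∫ x, (α * llr R P x + (1 - α) * llr R Q x) ∂ R + Real.log H.toReal := by
    rw [integral_congr_ae hl, integral_add hI (integrable_const _)]; simp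
  obtain ⟨n1, n2⟩ := aux_nonneg hRT hiT
  rw [← EReal.coe_neg, EReal.coe_le_coe_iff, EReal.coe_eq_coe_iff]
  refine ⟨by linarith, fun h => n2 (by linarith), fun h => ?_⟩
  have : ∫ x, llr R (renyiTilt α μ p q) x ∂ R = 0 := by
    rw [← h, integral_congr_ae (llr_self R)]; simp
  linarith

lemma aux_PQ {X : Type*} [MeasurableSpace X] {α : ℝ} (hα : 1 < α)
    {P Q : Measure X} (μ : Measure X) (p q : X → ℝ≥0∞) (hp : Measurable p) (hq : Measurable q)
    (hP : P = μ.withDensity p) (hQ : Q = μ.withDensity q)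
    (h1 : ∫⁻ y, p y ^ α * q y ^ (1 - α) ∂μ ≠ ⊤) : P ≪ Q := by
  have h2 := ae_lt_top (by fun_prop) h1
  refine Measure.AbsolutelyContinuous.mk fun s hs h => ?_
  rw [measure_eq_zero_iff_ae_notMem] at h ⊢
  rw [hQ, ae_withDensity_iff hq] at h
  rw [hP, ae_withDensity_iff hp]
  filter_upwards [h, h2] with x h h2 h3
  apply h
  intro h4
  rw [h4, ENNReal.zero_rpow_of_neg (by linarith), ENNReal.mul_top] at h2
  · exact lt_irrefl _ h2
  · intro h; rw [ENNReal.rpow_eq_zero_iff_of_pos (by linarith)] at h; exact h3 h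

lemma aux_klDiv_cases {X : Type*} [MeasurableSpace X] {R P : Measure X} (h : klDiv R P ≠ ⊤) :
    R ≪ P ∧ Integrable (llr R P) R := by
  by_contra hc
  exact h (if_neg hc)

lemma aux_klDiv_bot {X : Type*} [MeasurableSpace X] (R P : Measure X) : klDiv R P ≠ ⊥ := by
  unfold klDiv
  split_ifs <;> simp

lemma aux_intQ {X : Type*} [MeasurableSpace X] {α : ℝ} (hα : 1 < α)
    {P Q R : Measure X} [IsProbabilityMeasure P] [IsProbabilityMeasure Q] [IsProbabilityMeasure R]
    (μ : Measure X) [SigmaFinite μ] (p q : X → ℝ≥0∞) (hp : Measurable p) (hq : Measurable q)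
    (hP : P = μ.withDensity p) (hQ : Q = μ.withDensity q) (hRP : R ≪ P)
    (hiP : Integrable (llr R P) R)
    (h1 : ∫⁻ y, p y ^ α * q y ^ (1 - α) ∂μ ≠ ⊤) : R ≪ Q ∧ Integrable (llr R Q) R := by
  have hRQ := hRP.trans (aux_PQ hα μ p q hp hq hP hQ h1)
  refine ⟨hRQ, ?_⟩
  have h0 := aux_pos α μ p q hp hq hP hQ hRP hRQ
  have hprob := aux_prob α μ p q hp hq h0 h1
  obtain ⟨hRT, hl⟩ := aux_RT α μ p q hp hq hP hQ hRP hRQ h0 h1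
  obtain ⟨g, hg, hg'⟩ := aux_lower hRT
  obtain ⟨k, hk, hk'⟩ := aux_lower hRQ
  set H := ∫⁻ y, p y ^ α * q y ^ (1 - α) ∂μ with hH
  refine aux_sandwich (h := fun x => (α - 1)⁻¹ * (α * llr R P x + Real.log H.toReal + g x))
    (measurable_llr _ _) hk ?_ hk' ?_
  · exact (((hiP.const_mul _).add (integrable_const _)).add hg).const_mul _
  · filter_upwards [hl, hg'] with x h2 h3
    rw [inv_mul_eq_div, le_div_iff₀ (by linarith)]
    linarith

lemma aux_fin_of_ne_top {X : Type*} [MeasurableSpace X] {α : ℝ} (hα0 : 0 < α) (hα1 : α ≠ 1)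
    {P Q R : Measure X} [IsProbabilityMeasure P] [IsProbabilityMeasure Q] [IsProbabilityMeasure R]
    (μ : Measure X) [SigmaFinite μ] (p q : X → ℝ≥0∞) (hp : Measurable p) (hq : Measurable q)
    (hP : P = μ.withDensity p) (hQ : Q = μ.withDensity q)
    (h1 : ∫⁻ y, p y ^ α * q y ^ (1 - α) ∂μ ≠ ⊤) (hk : klMix α R P Q ≠ ⊤) :
    (R ≪ P ∧ Integrable (llr R P) R) ∧ (R ≪ Q ∧ Integrable (llr R Q) R) := by
  have hbP := aux_klDiv_bot R P
  have hbQ := aux_klDiv_bot R Q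
  have hPt : klDiv R P ≠ ⊤ := by
    intro h
    by_cases hQt : klDiv R Q = ⊤
    · exact hk (if_pos ⟨h, hQt⟩)
    · apply hk
      unfold klMix
      rw [if_neg (by tauto), h, EReal.coe_mul_top_of_pos hα0]
      lift klDiv R Q to ℝ using ⟨hQt, hbQ⟩ with y
      rw [← EReal.coe_mul]
      exact EReal.top_add_coe _
  obtain ⟨hRP, hiP⟩ := aux_klDiv_cases hPt
  refine ⟨⟨hRP, hiP⟩, ?_⟩
  rcases lt_or_gt_of_ne hα1 with hα | hα
  · apply aux_klDiv_cases
    intro h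
    apply hk
    unfold klMix
    rw [if_neg (by tauto), h, EReal.coe_mul_top_of_pos (by linarith)]
    lift klDiv R P to ℝ using ⟨hPt, hbP⟩ with y
    rw [← EReal.coe_mul]
    exact EReal.coe_add_top _
  · exact aux_intQ hα μ p q hp hq hP hQ hRP hiP h1

lemma aux_renyi {X : Type*} [MeasurableSpace X] {α : ℝ} (hα1 : α ≠ 1) (P Q : Measure X) :
    ((1 - α : ℝ) : EReal) * renyiSimple α P Q = - ENNReal.log (hellingerInt α P Q) := by
  unfold renyiSimple
  rw [← mul_assoc, ← EReal.coe_mul]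
  have : (1 - α) * (α - 1)⁻¹ = -1 := by
    have : α - 1 ≠ 0 := sub_ne_zero.2 hα1
    field_simp
    ring
  rw [this]
  simp

lemma aux_tilt_ac {X : Type*} [MeasurableSpace X] {α : ℝ} (hα0 : 0 < α) (hα1 : α < 1)
    {P Q : Measure X} (μ : Measure X) (p q : X → ℝ≥0∞) (hp : Measurable p) (hq : Measurable q)
    (hP : P = μ.withDensity p) (hQ : Q = μ.withDensity q) :
    renyiTilt α μ p q ≪ P ∧ renyiTilt α μ p q ≪ Q := by
  constructor
  · refine Measure.AbsolutelyContinuous.mk fun s hs h => ?_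
    rw [measure_eq_zero_iff_ae_notMem] at h ⊢
    rw [hP, ae_withDensity_iff hp] at h
    unfold renyiTilt
    rw [ae_withDensity_iff (by fun_prop)]
    filter_upwards [h] with x h h2
    apply h
    intro h3
    apply h2
    rw [h3, ENNReal.zero_rpow_of_pos hα0]; simp
  · refine Measure.AbsolutelyContinuous.mk fun s hs h => ?_
    rw [measure_eq_zero_iff_ae_notMem] at h ⊢
    rw [hQ, ae_withDensity_iff hq] at h
    unfold renyiTilt
    rw [ae_withDensity_iff (by fun_prop)]
    filter_upwards [h] with x h h2
    apply h
    intro h3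
    apply h2
    rw [h3, ENNReal.zero_rpow_of_pos (by linarith)]; simp

lemma aux_tilt_int {X : Type*} [MeasurableSpace X] {α : ℝ} (hα0 : 0 < α) (hα1 : α < 1)
    {P Q : Measure X} [IsProbabilityMeasure P] [IsProbabilityMeasure Q]
    (μ : Measure X) [SigmaFinite μ] (p q : X → ℝ≥0∞) (hp : Measurable p) (hq : Measurable q)
    (hP : P = μ.withDensity p) (hQ : Q = μ.withDensity q)
    (h0 : ∫⁻ y, p y ^ α * q y ^ (1 - α) ∂μ ≠ 0)
    (h1 : ∫⁻ y, p y ^ α * q y ^ (1 - α) ∂μ ≠ ⊤) :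
    Integrable (llr (renyiTilt α μ p q) P) (renyiTilt α μ p q) ∧
    Integrable (llr (renyiTilt α μ p q) Q) (renyiTilt α μ p q) := by
  have hprob := aux_prob α μ p q hp hq h0 h1
  obtain ⟨hTP, hTQ⟩ := aux_tilt_ac hα0 hα1 μ p q hp hq hP hQ
  obtain ⟨-, hl⟩ := aux_RT α μ p q hp hq hP hQ hTP hTQ h0 h1
  have hs := llr_self (renyiTilt α μ p q)
  obtain ⟨g, hg, hg'⟩ := aux_lower hTP
  obtain ⟨k, hk, hk'⟩ := aux_lower hTQ
  set H := ∫⁻ y, p y ^ α * q y ^ (1 - α) ∂μ with hH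
  constructor
  · refine aux_sandwich (h := fun x => α⁻¹ * ((1 - α) * k x + - Real.log H.toReal))
      (measurable_llr _ _) hg ?_ hg' ?_
    · exact ((hk.const_mul _).add (integrable_const _)).const_mul _
    · filter_upwards [hl, hs, hk'] with x h2 h3 h4
      rw [inv_mul_eq_div, le_div_iff₀ hα0]
      simp only [Pi.zero_apply] at h3
      nlinarith [mul_le_mul_of_nonneg_left h4 (by linarith : 0 ≤ 1 - α)]
  · refine aux_sandwich (h := fun x => (1 - α)⁻¹ * (α * g x + - Real.log H.toReal))
      (measurable_llr _ _) hk ?_ hk' ?_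
    · exact ((hg.const_mul _).add (integrable_const _)).const_mul _
    · filter_upwards [hl, hs, hg'] with x h2 h3 h4
      rw [inv_mul_eq_div, le_div_iff₀ (by linarith)]
      simp only [Pi.zero_apply] at h3
      nlinarith [mul_le_mul_of_nonneg_left h4 hα0.le]

lemma aux_lowerbd {X : Type*} [MeasurableSpace X] {α : ℝ} (hα0 : 0 < α) (hα1 : α ≠ 1)
    {P Q R : Measure X} [IsProbabilityMeasure P] [IsProbabilityMeasure Q] [IsProbabilityMeasure R]
    (μ : Measure X) [SigmaFinite μ] (p q : X → ℝ≥0∞) (hp : Measurable p) (hq : Measurable q)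
    (hP : P = μ.withDensity p) (hQ : Q = μ.withDensity q) :
    - ENNReal.log (∫⁻ y, p y ^ α * q y ^ (1 - α) ∂μ) ≤ klMix α R P Q := by
  by_cases h1 : ∫⁻ y, p y ^ α * q y ^ (1 - α) ∂μ = ⊤
  · rw [h1]; simp
  by_cases hk : klMix α R P Q = ⊤
  · rw [hk]; exact le_top
  obtain ⟨⟨a, b⟩, c, d⟩ := aux_fin_of_ne_top hα0 hα1 μ p q hp hq hP hQ h1 hk
  exact (aux_key α μ p q hp hq hP hQ a c b d h1).1

lemma aux_part2 {X : Type*} [MeasurableSpace X] {α : ℝ} (hα0 : 0 < α) (hα1 : α ≠ 1)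
    {P Q : Measure X} [IsProbabilityMeasure P] [IsProbabilityMeasure Q]
    (μ : Measure X) [SigmaFinite μ] (p q : X → ℝ≥0∞) (hp : Measurable p) (hq : Measurable q)
    (hP : P = μ.withDensity p) (hQ : Q = μ.withDensity q)
    (h0 : ∫⁻ y, p y ^ α * q y ^ (1 - α) ∂μ ≠ 0)
    (h1 : ∫⁻ y, p y ^ α * q y ^ (1 - α) ∂μ ≠ ⊤)
    (h : α < 1 ∨ klDiv (renyiTilt α μ p q) P < ⊤) :
    klMix α (renyiTilt α μ p q) P Q = - ENNReal.log (∫⁻ y, p y ^ α * q y ^ (1 - α) ∂μ) ∧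
      ∀ R : Measure X, IsProbabilityMeasure R →
        klMix α R P Q = - ENNReal.log (∫⁻ y, p y ^ α * q y ^ (1 - α) ∂μ) →
        R = renyiTilt α μ p q := by
  have hprob := aux_prob α μ p q hp hq h0 h1
  constructor
  · have : (renyiTilt α μ p q ≪ P ∧ Integrable (llr (renyiTilt α μ p q) P) (renyiTilt α μ p q)) ∧
      (renyiTilt α μ p q ≪ Q ∧ Integrable (llr (renyiTilt α μ p q) Q) (renyiTilt α μ p q)) := by
      by_cases hα : α < 1
      · obtain ⟨a, b⟩ := aux_tilt_ac hα0 hα μ p q hp hq hP hQ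
        obtain ⟨c, d⟩ := aux_tilt_int hα0 hα μ p q hp hq hP hQ h0 h1
        exact ⟨⟨a, c⟩, b, d⟩
      · have hf := aux_klDiv_cases (h.resolve_left hα).ne
        exact ⟨hf, aux_intQ (lt_of_le_of_ne (not_lt.1 hα) hα1.symm) μ p q hp hq hP hQ hf.1 hf.2 h1⟩
    obtain ⟨⟨a, b⟩, c, d⟩ := this
    exact (aux_key α μ p q hp hq hP hQ a c b d h1).2.2 rfl
  · intro R hR hk
    have hkt : klMix α R P Q ≠ ⊤ := by
      rw [hk, ENNReal.log_pos_real h0 h1, ← EReal.coe_neg]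
      exact EReal.coe_ne_top _
    obtain ⟨⟨a, b⟩, c, d⟩ := aux_fin_of_ne_top hα0 hα1 μ p q hp hq hP hQ h1 hkt
    exact (aux_key α μ p q hp hq hP hQ a c b d h1).2.1 hk

def auxB {X : Type*} (p q : X → ℝ≥0∞) (n : ℕ) : Set X :=
  {x | p x ≠ 0 ∧ p x ≠ ⊤ ∧ q x ≠ 0 ∧ q x ≠ ⊤ ∧ |Real.log (p x).toReal| ≤ n ∧
    |Real.log (q x).toReal| ≤ n}

lemma auxB_meas {X : Type*} [MeasurableSpace X] {p q : X → ℝ≥0∞} (hp : Measurable p)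
    (hq : Measurable q) (n : ℕ) : MeasurableSet (auxB p q n) := by
  have a1 : MeasurableSet {x | p x = 0} := hp (measurableSet_singleton 0)
  have a2 : MeasurableSet {x | p x = ⊤} := hp (measurableSet_singleton ⊤)
  have a3 : MeasurableSet {x | q x = 0} := hq (measurableSet_singleton 0)
  have a4 : MeasurableSet {x | q x = ⊤} := hq (measurableSet_singleton ⊤)
  have a5 : MeasurableSet {x | |Real.log (p x).toReal| ≤ n} :=
    measurableSet_le (by fun_prop) measurable_const
  have a6 : MeasurableSet {x | |Real.log (q x).toReal| ≤ n} :=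
    measurableSet_le (by fun_prop) measurable_const
  exact a1.compl.inter (a2.compl.inter (a3.compl.inter (a4.compl.inter (a5.inter a6))))

lemma auxB_mono {X : Type*} (p q : X → ℝ≥0∞) : Monotone (auxB p q) := by
  intro m n h x hx
  obtain ⟨a, b, c, d, e, f⟩ := hx
  have : (m : ℝ) ≤ n := by exact_mod_cast h
  exact ⟨a, b, c, d, e.trans this, f.trans this⟩

lemma auxB_union {X : Type*} (p q : X → ℝ≥0∞) {x : X} (h1 : p x ≠ 0) (h2 : p x ≠ ⊤)
    (h3 : q x ≠ 0) (h4 : q x ≠ ⊤) : x ∈ ⋃ n, auxB p q n := by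
  obtain ⟨n, hn⟩ := exists_nat_ge (max |Real.log (p x).toReal| |Real.log (q x).toReal|)
  exact mem_iUnion.2 ⟨n, h1, h2, h3, h4, (le_max_left _ _).trans hn, (le_max_right _ _).trans hn⟩

lemma aux_val {α : ℝ} {a b : ℝ≥0∞} (ha : a ≠ 0) (ha' : a ≠ ⊤) (hb : b ≠ 0) (hb' : b ≠ ⊤) :
    Real.log (a ^ α * b ^ (1 - α)).toReal = α * Real.log a.toReal + (1 - α) * Real.log b.toReal ∧
    a ^ α * b ^ (1 - α) ≠ 0 ∧ a ^ α * b ^ (1 - α) ≠ ⊤ := by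
  have a4 := ENNReal.toReal_pos ha ha'
  have a5 := ENNReal.toReal_pos hb hb'
  refine ⟨?_, ?_, ?_⟩
  · rw [ENNReal.toReal_mul, ← ENNReal.toReal_rpow,
      ← ENNReal.toReal_rpow,
      Real.log_mul (by positivity) (by positivity), Real.log_rpow a4, Real.log_rpow a5]
  · exact mul_ne_zero (ENNReal.rpow_pos (pos_iff_ne_zero.2 ha) ha').ne'
      (ENNReal.rpow_pos (pos_iff_ne_zero.2 hb) hb').ne'
  · exact ENNReal.mul_ne_top (ENNReal.rpow_ne_top_of_ne_zero ha ha')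
      (ENNReal.rpow_ne_top_of_ne_zero hb hb')

lemma aux_approx {X : Type*} [MeasurableSpace X] {α : ℝ}
    {P Q : Measure X} [IsProbabilityMeasure P] [IsProbabilityMeasure Q]
    (μ : Measure X) [IsFiniteMeasure μ] (p q : X → ℝ≥0∞) (hp : Measurable p) (hq : Measurable q)
    (hP : P = μ.withDensity p) (hQ : Q = μ.withDensity q) (n : ℕ)
    (h0 : ∫⁻ y in auxB p q n, p y ^ α * q y ^ (1 - α) ∂μ ≠ 0) :
    ∃ R : Measure X, IsProbabilityMeasure R ∧
      klMix α R P Q = - ENNReal.log (∫⁻ y in auxB p q n, p y ^ α * q y ^ (1 - α) ∂μ) := by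
  have hB := auxB_meas hp hq n
  have hval : ∀ x ∈ auxB p q n, Real.log (p x ^ α * q x ^ (1 - α)).toReal =
      α * Real.log (p x).toReal + (1 - α) * Real.log (q x).toReal ∧
      p x ^ α * q x ^ (1 - α) ≠ 0 ∧ p x ^ α * q x ^ (1 - α) ≠ ⊤ :=
    fun x hx => aux_val hx.1 hx.2.1 hx.2.2.1 hx.2.2.2.1
  have h1 : ∫⁻ y in auxB p q n, p y ^ α * q y ^ (1 - α) ∂μ ≠ ⊤ := by
    have hle : ∫⁻ y in auxB p q n, p y ^ α * q y ^ (1 - α) ∂μ ≤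
        ∫⁻ y in auxB p q n, ENNReal.ofReal (Real.exp (|α| * n + |1 - α| * n)) ∂μ := by
      apply setLIntegral_mono' hB
      intro x hx
      obtain ⟨e, f, g⟩ := hval x hx
      rw [← ENNReal.ofReal_toReal g]
      apply ENNReal.ofReal_le_ofReal
      rw [← Real.log_le_iff_le_exp (ENNReal.toReal_pos f g), e]
      have b1 : α * Real.log (p x).toReal ≤ |α| * n :=
        (le_abs_self _).trans (by rw [abs_mul]; gcongr; exact hx.2.2.2.2.1)
      have b2 : (1 - α) * Real.log (q x).toReal ≤ |1 - α| * n :=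
        (le_abs_self _).trans (by rw [abs_mul]; gcongr; exact hx.2.2.2.2.2)
      linarith
    refine ne_top_of_le_ne_top ?_ hle
    rw [setLIntegral_const]
    exact ENNReal.mul_ne_top ENNReal.ofReal_ne_top (measure_ne_top _ _)
  set H := ∫⁻ y in auxB p q n, p y ^ α * q y ^ (1 - α) ∂μ with hH
  set t : X → ℝ≥0∞ := (auxB p q n).indicator (fun x => p x ^ α * q x ^ (1 - α) / H) with ht
  have htm : Measurable t := Measurable.indicator (by fun_prop) hB
  set R := μ.withDensity t with hR
  have hRprob : IsProbabilityMeasure R := by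
    constructor
    rw [hR, withDensity_apply _ MeasurableSet.univ, Measure.restrict_univ, ht,
      lintegral_indicator hB]
    simp only [div_eq_mul_inv]
    rw [lintegral_mul_const _ (by fun_prop), ENNReal.mul_inv_cancel h0 h1]
  have hRB : ∀ᵐ x ∂ R, x ∈ auxB p q n := by
    rw [hR, ae_withDensity_iff htm]
    filter_upwards with x hx
    by_contra hc
    exact hx (indicator_of_notMem hc _)
  have hRμ : R ≪ μ := withDensity_absolutelyContinuous _ _
  have hac : ∀ (S : Measure X) (s : X → ℝ≥0∞), Measurable s → S = μ.withDensity s →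
      (∀ x ∈ auxB p q n, s x ≠ 0) → R ≪ S := by
    intro S s hs hS hne
    refine Measure.AbsolutelyContinuous.mk fun A hA h => ?_
    rw [measure_eq_zero_iff_ae_notMem] at h ⊢
    rw [hS, ae_withDensity_iff hs] at h
    have h := hRμ.ae_le h
    filter_upwards [h, hRB] with x h h2
    exact h (hne x h2)
  have hRP : R ≪ P := hac P p hp hP fun x hx => hx.1
  have hRQ : R ≪ Q := hac Q q hq hQ fun x hx => hx.2.2.1
  have hd : R.rnDeriv μ =ᵐ[R] t := hRμ.ae_le (Measure.rnDeriv_withDensity μ htm)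
  have hlog : ∀ᵐ x ∂ R, Real.log (R.rnDeriv μ x).toReal =
      α * Real.log (p x).toReal + (1 - α) * Real.log (q x).toReal - Real.log H.toReal := by
    filter_upwards [hd, hRB] with x hx hxB
    obtain ⟨e, f, g⟩ := hval x hxB
    rw [hx, ht, indicator_of_mem hxB, ENNReal.toReal_div,
      Real.log_div (ENNReal.toReal_pos f g).ne' (ENNReal.toReal_pos h0 h1).ne', e]
  have ip : Integrable (fun x => Real.log (p x).toReal) R := by
    refine Integrable.of_bound (hp.ennreal_toReal.log.aestronglyMeasurable) (n : ℝ) ?_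
    filter_upwards [hRB] with x hx using hx.2.2.2.2.1
  have iq : Integrable (fun x => Real.log (q x).toReal) R := by
    refine Integrable.of_bound (hq.ennreal_toReal.log.aestronglyMeasurable) (n : ℝ) ?_
    filter_upwards [hRB] with x hx using hx.2.2.2.2.2
  have il : Integrable (fun x => Real.log (R.rnDeriv μ x).toReal) R := by
    refine (((ip.const_mul α).add (iq.const_mul (1 - α))).sub
      (integrable_const (Real.log H.toReal))).congr ?_
    filter_upwards [hlog] with x hx using hx.symm
  have lP := aux_llr hp hP hRP
  have lQ := aux_llr hq hQ hRQ
  have iP : Integrable (llr R P) R := (il.sub ip).congr lP.symm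
  have iQ : Integrable (llr R Q) R := (il.sub iq).congr lQ.symm
  refine ⟨R, hRprob, ?_⟩
  rw [aux_klMix_fin α hRP hRQ iP iQ, ENNReal.log_pos_real h0 h1, ← EReal.coe_neg,
    EReal.coe_eq_coe_iff]
  have : (fun x => α * llr R P x + (1 - α) * llr R Q x) =ᵐ[R] fun _ => - Real.log H.toReal := by
    filter_upwards [lP, lQ, hlog] with x h1 h2 h3
    rw [h1, h2, h3]; ring
  rw [integral_congr_ae this]
  simp

lemma aux_sup {X : Type*} [MeasurableSpace X] {α : ℝ} (hα0 : 0 < α)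
    {P Q : Measure X} [IsProbabilityMeasure P] [IsProbabilityMeasure Q]
    (μ : Measure X) (p q : X → ℝ≥0∞) (hp : Measurable p) (hq : Measurable q)
    (hP : P = μ.withDensity p) (hQ : Q = μ.withDensity q) (h : α < 1 ∨ P ≪ Q) :
    ∫⁻ y, p y ^ α * q y ^ (1 - α) ∂μ =
      ⨆ n, ∫⁻ y in auxB p q n, p y ^ α * q y ^ (1 - α) ∂μ := by
  rw [← setLIntegral_iUnion_of_directed _ (auxB_mono p q).directed_le,
    ← lintegral_indicator (MeasurableSet.iUnion fun n => auxB_meas hp hq n)]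
  apply lintegral_congr_ae
  have fin : ∀ (S : Measure X) [IsProbabilityMeasure S] (s : X → ℝ≥0∞), Measurable s →
      S = μ.withDensity s → ∀ᵐ x ∂μ, s x < ⊤ := by
    intro S _ s hs hS
    refine ae_lt_top hs ?_
    have := measure_univ (μ := S)
    rw [hS, withDensity_apply _ MeasurableSet.univ, Measure.restrict_univ] at this
    simp [this]
  have hz : ∀ᵐ x ∂μ, p x ≠ 0 → q x = 0 → α < 1 := by
    rcases h with h | h
    · exact Eventually.of_forall fun _ _ _ => h
    · have := aux_fin hq hQ h
      rw [hP, ae_withDensity_iff hp] at this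
      filter_upwards [this] with x hx h1 h2
      exact absurd h2 (hx h1).1
  filter_upwards [fin P p hp hP, fin Q q hq hQ, hz] with x h1 h2 h3
  by_cases hx : x ∈ ⋃ n, auxB p q n
  · rw [indicator_of_mem hx]
  rw [indicator_of_notMem hx]
  by_cases hp0 : p x = 0
  · rw [hp0, ENNReal.zero_rpow_of_pos hα0, zero_mul]
  by_cases hq0 : q x = 0
  · have := h3 hp0 hq0
    rw [hq0, ENNReal.zero_rpow_of_pos (by linarith), mul_zero]
  · exact absurd (auxB_union p q hp0 h1.ne hq0 h2.ne) hx

lemma aux_upper1 {X : Type*} [MeasurableSpace X] {α : ℝ} (hα0 : 0 < α)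
    {P Q : Measure X} [IsProbabilityMeasure P] [IsProbabilityMeasure Q]
    (μ : Measure X) [IsFiniteMeasure μ] (p q : X → ℝ≥0∞) (hp : Measurable p) (hq : Measurable q)
    (hP : P = μ.withDensity p) (hQ : Q = μ.withDensity q) (h : α < 1 ∨ P ≪ Q) :
    ⨅ (R : Measure X) (_ : IsProbabilityMeasure R), klMix α R P Q ≤
      - ENNReal.log (∫⁻ y, p y ^ α * q y ^ (1 - α) ∂μ) := by
  have hmono : Monotone fun n => ∫⁻ y in auxB p q n, p y ^ α * q y ^ (1 - α) ∂μ :=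
    fun m n hmn => lintegral_mono_set (auxB_mono p q hmn)
  have ht := tendsto_atTop_iSup hmono
  rw [← aux_sup hα0 μ p q hp hq hP hQ h] at ht
  have ht2 := (ENNReal.continuous_log.tendsto _).comp ht
  have ht3 := (continuous_neg.tendsto _).comp ht2
  refine ge_of_tendsto' ht3 fun n => ?_
  simp only [Function.comp]
  by_cases h0 : ∫⁻ y in auxB p q n, p y ^ α * q y ^ (1 - α) ∂μ = 0
  · rw [h0]; simp
  · obtain ⟨R, hR, e⟩ := aux_approx μ p q hp hq hP hQ n h0
    rw [← e]
    exact iInf₂_le R hR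

lemma aux_upper2 {X : Type*} [MeasurableSpace X] {α : ℝ} (hα : 1 < α)
    {P Q : Measure X} [IsProbabilityMeasure P] [IsProbabilityMeasure Q] (h : ¬ P ≪ Q) :
    ⨅ (R : Measure X) (_ : IsProbabilityMeasure R), klMix α R P Q = ⊥ := by
  obtain ⟨s, hs, hQs, hPs⟩ : ∃ s, MeasurableSet s ∧ Q s = 0 ∧ P s ≠ 0 := by
    by_contra hc
    push Not at hc
    exact h (Measure.AbsolutelyContinuous.mk fun s hs h0 => hc s hs h0)
  have hcd : MeasurableSet s := hs
  set R := P.withDensity (s.indicator fun _ => (P s)⁻¹) with hR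
  have hm : Measurable (s.indicator fun _ => (P s)⁻¹) := measurable_const.indicator hs
  have hRprob : IsProbabilityMeasure R := by
    constructor
    rw [hR, withDensity_apply _ MeasurableSet.univ, Measure.restrict_univ,
      lintegral_indicator hs, setLIntegral_const,
      ENNReal.inv_mul_cancel hPs (measure_ne_top _ _)]
  have hRP : R ≪ P := withDensity_absolutelyContinuous _ _
  have hRs : ∀ᵐ x ∂ R, x ∈ s := by
    rw [hR, ae_withDensity_iff hm]
    filter_upwards with x hx
    by_contra hc
    exact hx (indicator_of_notMem hc _)
  have hl : llr R P =ᵐ[R] fun _ => Real.log ((P s)⁻¹).toReal := by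
    filter_upwards [hRP.ae_le (Measure.rnDeriv_withDensity P hm), hRs] with x h1 h2
    rw [llr, h1, indicator_of_mem h2]
  have hi : Integrable (llr R P) R := (integrable_const _).congr hl.symm
  have hQ : klDiv R Q = ⊤ := by
    refine if_neg fun hc => ?_
    have h0 := hc.1 hQs
    rw [measure_eq_zero_iff_ae_notMem] at h0
    have : ∀ᵐ x ∂ R, False := by
      filter_upwards [h0, hRs] with x a b using a b
    simp at this
    exact IsProbabilityMeasure.ne_zero R this
  have hPk : klDiv R P = ((∫ x, llr R P x ∂ R : ℝ) : EReal) := if_pos ⟨hRP, hi⟩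
  rw [eq_bot_iff]
  refine (iInf₂_le R hRprob).trans ?_
  unfold klMix
  rw [hQ, hPk, if_neg (by simp), EReal.coe_mul_top_of_neg (by linarith), EReal.add_bot]

/-- For any simple order `α ∈ (0,1) ∪ (1,∞)`,
`(1-α) D_α(P‖Q) = inf_R { α D(R‖P) + (1-α) D(R‖Q) }`, the infimum being over all
probability distributions `R`; moreover, if `P_α` is well defined (i.e.
`0 < ∫ p^α q^(1-α) dμ < ∞`) and `α ∈ (0,1)` or `D(P_α‖P) < ∞`, then the infimum is
uniquely achieved by `R = P_α`. -/
theorem renyiDiv_eq_inf_klMix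
    {X : Type*} [MeasurableSpace X] (α : ℝ) (hα0 : 0 < α) (hα1 : α ≠ 1)
    (P Q : Measure X) [IsProbabilityMeasure P] [IsProbabilityMeasure Q] :
    (((1 - α : ℝ) : EReal) * renyiSimple α P Q =
      ⨅ (R : Measure X) (_ : IsProbabilityMeasure R), klMix α R P Q) ∧
    (∀ (μ : Measure X) [SigmaFinite μ], ∀ (p q : X → ℝ≥0∞),
      Measurable p → Measurable q →
      P = μ.withDensity p → Q = μ.withDensity q →
      0 < ∫⁻ y, p y ^ α * q y ^ (1 - α) ∂μ →
      (∫⁻ y, p y ^ α * q y ^ (1 - α) ∂μ) ≠ ⊤ →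
      (α < 1 ∨ klDiv (renyiTilt α μ p q) P < ⊤) →
      klMix α (renyiTilt α μ p q) P Q = ((1 - α : ℝ) : EReal) * renyiSimple α P Q ∧
      ∀ R : Measure X, IsProbabilityMeasure R →
        klMix α R P Q = ((1 - α : ℝ) : EReal) * renyiSimple α P Q →
        R = renyiTilt α μ p q) := by
  have hPS : P ≪ P + Q := Measure.AbsolutelyContinuous.rfl.add_right _
  have hQS : Q ≪ P + Q := by
    rw [add_comm]; exact Measure.AbsolutelyContinuous.rfl.add_right _
  rw [aux_renyi hα1]
  constructor
  · have hp := Measure.measurable_rnDeriv P (P + Q)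
    have hq := Measure.measurable_rnDeriv Q (P + Q)
    have hP := (Measure.withDensity_rnDeriv_eq P (P + Q) hPS).symm
    have hQ := (Measure.withDensity_rnDeriv_eq Q (P + Q) hQS).symm
    rw [aux_hell α hα0 P Q (P + Q) _ _ hp hq hP hQ]
    apply le_antisymm
    · refine le_iInf₂ fun R hR => ?_
      exact aux_lowerbd hα0 hα1 (P + Q) _ _ hp hq hP hQ
    · by_cases h : α < 1 ∨ P ≪ Q
      · exact aux_upper1 hα0 (P + Q) _ _ hp hq hP hQ h
      · push Not at h
        rw [aux_upper2 (lt_of_le_of_ne h.1 hα1.symm) h.2]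
        exact bot_le
  · intro μ _ p q hp hq hP hQ h0 h1 h
    rw [aux_hell α hα0 P Q μ p q hp hq hP hQ]
    exact aux_part2 hα0 hα1 μ p q hp hq hP hQ h0.ne' h1 h
end
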